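/- arXiv:1407.1167 — 4 statements merged into one kernel-verified Lean document; each statement's English description precedes it below -/
import Mathlib

section
/- For the StackMST(0,0) game whose red tree is a path P all of whose edge costs lie in {a, b} with 0 ≤ a < b, and where σ denotes the number of bad a-blocks of P, the optimal revenue satisfies r*(P, c) ≤ c(P) − min{ σ·a , ⌊σ/2⌋·(b − a) + (σ − 2·⌊σ/2⌋)·min{a, b − a} }. -/
namespace StackMST

variable {V : Type*}

/-- Sum of an edge-weight function over a set of edges. -/
noncomputable def esum (w : Sym2 V → ℝ) (s : Set (Sym2 V)) : ℝ := ∑ᶠ e ∈ s, w e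

/-- `M` is a spanning tree of `G`. -/
def IsSpanningTreeOf (G M : SimpleGraph V) : Prop := M ≤ G ∧ M.IsTree

/-- Total weight of `M`, where red edges (the edges of `T`) are weighted by `c`
and all other (blue) edges are weighted by `p`. -/
noncomputable def weight (T : SimpleGraph V) (c p : Sym2 V → ℝ) (M : SimpleGraph V) : ℝ :=
  esum c (M.edgeSet ∩ T.edgeSet) + esum p (M.edgeSet \ T.edgeSet)

/-- Total price of the blue edges of `M`. -/
noncomputable def blueRevenue (T : SimpleGraph V) (p : Sym2 V → ℝ) (M : SimpleGraph V) : ℝ :=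
  esum p (M.edgeSet \ T.edgeSet)

/-- The leader's revenue once `F` and `p` are fixed: the follower selects a
minimum-weight spanning tree of `T ⊔ F` and, among those, one maximizing the
total price of the blue edges it contains. -/
noncomputable def followerRevenue (T : SimpleGraph V) (c : Sym2 V → ℝ)
    (F : SimpleGraph V) (p : Sym2 V → ℝ) : ℝ :=
  sSup {r | ∃ M : SimpleGraph V, IsSpanningTreeOf (T ⊔ F) M ∧
    (∀ M' : SimpleGraph V, IsSpanningTreeOf (T ⊔ F) M' →
        weight T c p M ≤ weight T c p M') ∧
    r = blueRevenue T p M}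

/-- `F` is a set of blue edges: none of its edges is a red edge. -/
def IsBlueSet (T F : SimpleGraph V) : Prop := F ≤ Tᶜ

/-- `r(F)`: the best revenue the leader can obtain from the activated set `F`. -/
noncomputable def revenueOf (T : SimpleGraph V) (c : Sym2 V → ℝ) (F : SimpleGraph V) : ℝ :=
  sSup {r | ∃ p : Sym2 V → ℝ, (∀ e ∈ F.edgeSet, 0 ≤ p e) ∧ r = followerRevenue T c F p}

/-- Optimal revenue `r*(T, c)` of the StackMST(0,0) game on the red tree `T`. -/
noncomputable def optRevenue (T : SimpleGraph V) (c : Sym2 V → ℝ) : ℝ :=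
  sSup {r | ∃ (F : SimpleGraph V) (p : Sym2 V → ℝ), IsBlueSet T F ∧
    (∀ e ∈ F.edgeSet, 0 ≤ p e) ∧ r = followerRevenue T c F p}

/-- Total cost `c(T)` of the red edges. -/
noncomputable def redCost (T : SimpleGraph V) (c : Sym2 V → ℝ) : ℝ := esum c T.edgeSet

/-- Optimal revenue of the budgeted game StackMST(γ, Δ). -/
noncomputable def gammaOptRevenue (T : SimpleGraph V) (c γ : Sym2 V → ℝ) (Δ : ℝ) : ℝ :=
  sSup {r | ∃ F : SimpleGraph V, IsBlueSet T F ∧ esum γ F.edgeSet ≤ Δ ∧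
    r = revenueOf T c F}

end StackMST

namespace StackMST

/-- The `i`-th red edge of the path graph on `Fin (m+1)`,
joining vertex `i` to vertex `i+1`. -/
def pathEdge (m : ℕ) (i : Fin m) : Sym2 (Fin (m+1)) := s(Fin.castSucc i, Fin.succ i)

/-- The consecutive edges `l, …, r` of the path form an `a`-block:
all of them have cost `a` and the run is maximal. -/
def IsABlock (m : ℕ) (c : Sym2 (Fin (m+1)) → ℝ) (a : ℝ) (l r : Fin m) : Prop :=
  l ≤ r ∧
  (∀ i : Fin m, l ≤ i → i ≤ r → c (pathEdge m i) = a) ∧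
  (∀ i : Fin m, (i : ℕ) + 1 = (l : ℕ) → c (pathEdge m i) ≠ a) ∧
  (∀ i : Fin m, (r : ℕ) + 1 = (i : ℕ) → c (pathEdge m i) ≠ a)

/-- A bad `a`-block: an `a`-block with at most 2 edges. -/
def IsBadBlock (m : ℕ) (c : Sym2 (Fin (m+1)) → ℝ) (a : ℝ) (l r : Fin m) : Prop :=
  IsABlock m c a l r ∧ (r : ℕ) ≤ (l : ℕ) + 1

/-- `σ`: the number of bad `a`-blocks of the path. -/
noncomputable def badBlockCount (m : ℕ) (c : Sym2 (Fin (m+1)) → ℝ) (a : ℝ) : ℕ :=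
  Set.ncard {q : Fin m × Fin m | IsBadBlock m c a q.1 q.2}

/-- `min { σ·a , ⌊σ/2⌋·(b − a) + (σ − 2·⌊σ/2⌋)·min{a, b − a} }`. -/
noncomputable def twoCostBound (a b : ℝ) (σ : ℕ) : ℝ :=
  min ((σ : ℝ) * a)
    (((σ / 2 : ℕ) : ℝ) * (b - a) + ((σ : ℝ) - 2 * ((σ / 2 : ℕ) : ℝ)) * min a (b - a))

end StackMST

namespace StackMST

open SimpleGraph Classical

section generic
set_option linter.unusedSectionVars false
variable {V : Type*} [Fintype V]

/-- Edges of `M` as a finset. -/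
noncomputable def edg (M : SimpleGraph V) : Finset (Sym2 V) := M.edgeSet.toFinite.toFinset

lemma mem_edg (M : SimpleGraph V) (e : Sym2 V) : e ∈ edg M ↔ e ∈ M.edgeSet := by
  simp [edg]

/-- The weight of an edge. -/
noncomputable def wt (T : SimpleGraph V) (c p : Sym2 V → ℝ) (e : Sym2 V) : ℝ :=
  if e ∈ T.edgeSet then c e else p e

lemma esum_eq (w : Sym2 V → ℝ) (s : Set (Sym2 V)) : esum w s = ∑ e ∈ s.toFinite.toFinset, w e := by
  unfold esum
  rw [finsum_mem_eq_finite_toFinset_sum]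

lemma esum_red (T M : SimpleGraph V) (w : Sym2 V → ℝ) :
    esum w (M.edgeSet ∩ T.edgeSet) = ∑ e ∈ (edg M).filter (fun e => e ∈ T.edgeSet), w e := by
  rw [esum_eq]
  apply Finset.sum_congr _ (fun _ _ => rfl)
  ext e; simp [mem_edg]

lemma esum_blue (T M : SimpleGraph V) (w : Sym2 V → ℝ) :
    esum w (M.edgeSet \ T.edgeSet) = ∑ e ∈ (edg M).filter (fun e => ¬ e ∈ T.edgeSet), w e := by
  rw [esum_eq]
  apply Finset.sum_congr _ (fun _ _ => rfl)
  ext e; simp [mem_edg]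

lemma weight_eq (T : SimpleGraph V) (c p : Sym2 V → ℝ) (M : SimpleGraph V) :
    weight T c p M = ∑ e ∈ edg M, wt T c p e := by
  unfold weight wt
  rw [esum_red, esum_blue, Finset.sum_ite]

lemma tree_card {M : SimpleGraph V} (h : M.IsTree) : (edg M).card + 1 = Fintype.card V := by
  rw [← h.card_edgeFinset]
  congr 2
  ext e; simp [mem_edg]

/-- The edges of `M` of weight at most `a`. -/
noncomputable def low (M : SimpleGraph V) (w : Sym2 V → ℝ) (a : ℝ) : SimpleGraph V :=
  M.deleteEdges {e | a < w e}

lemma mem_low (M : SimpleGraph V) (w : Sym2 V → ℝ) (a : ℝ) (e : Sym2 V) :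
    e ∈ (low M w a).edgeSet ↔ e ∈ M.edgeSet ∧ w e ≤ a := by
  simp [low, edgeSet_deleteEdges]

lemma low_le (M : SimpleGraph V) (w : Sym2 V → ℝ) (a : ℝ) : low M w a ≤ M :=
  deleteEdges_le _

/-- Any graph has at least `|V| - #components` edges. -/
lemma card_comp (G : SimpleGraph V) [Nonempty V] :
    Fintype.card V ≤ (edg G).card + Fintype.card G.ConnectedComponent := by
  obtain ⟨v0⟩ := ‹Nonempty V›
  let S : Finset (Sym2 V) :=
    (Finset.univ.erase (G.connectedComponentMk v0)).image (fun C => s(v0, C.out))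
  let H : SimpleGraph V := G ⊔ fromEdgeSet (S : Set (Sym2 V))
  have hout : ∀ x, G.Reachable x (G.connectedComponentMk x).out := fun x =>
    (ConnectedComponent.exact (Quot.out_eq (G.connectedComponentMk x))).symm
  have hx : ∀ x, H.Reachable v0 x := by
    intro x
    by_cases h : G.connectedComponentMk x = G.connectedComponentMk v0
    · exact ((ConnectedComponent.exact h).symm).mono le_sup_left
    · have h1 : H.Reachable x (G.connectedComponentMk x).out := (hout x).mono le_sup_left
      by_cases h2 : v0 = (G.connectedComponentMk x).out
      · rw [← h2] at h1; exact h1.symm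
      · refine Reachable.trans (Adj.reachable ?_) h1.symm
        right
        rw [fromEdgeSet_adj]
        refine ⟨?_, h2⟩
        simp only [S, Finset.coe_image, Set.mem_image]
        exact ⟨G.connectedComponentMk x, by simpa using h, rfl⟩
  have hconn : H.Connected := by
    have : Nonempty V := ⟨v0⟩
    exact ⟨fun x y => (hx x).symm.trans (hx y)⟩
  have h1 := hconn.card_vert_le_card_edgeSet_add_one
  have h2 : Nat.card H.edgeSet ≤ (edg G ∪ S).card := by
    rw [Nat.card_coe_set_eq, ← Set.ncard_coe_finset]
    apply Set.ncard_le_ncard _ (Finset.finite_toSet _)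
    intro e he
    have he' : e ∈ G.edgeSet ∪ (fromEdgeSet (S : Set (Sym2 V))).edgeSet := by
      rw [← edgeSet_sup]; exact he
    rw [edgeSet_fromEdgeSet] at he'
    rw [Finset.mem_coe, Finset.mem_union, mem_edg]
    rcases he' with h | h
    · exact Or.inl h
    · exact Or.inr (Finset.mem_coe.mp h.1)
  have h3 := Finset.card_union_le (edg G) S
  have h4 : S.card ≤ Fintype.card G.ConnectedComponent - 1 := by
    refine Finset.card_image_le.trans ?_
    rw [Finset.card_erase_of_mem (Finset.mem_univ _)]; rfl
  have h5 : 0 < Fintype.card G.ConnectedComponent :=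
    Fintype.card_pos_iff.mpr ⟨G.connectedComponentMk v0⟩
  rw [Nat.card_eq_fintype_card] at h1
  omega

/-- Non-lonely points of a surjection. -/
lemma fiber_count {A B : Type*} [Fintype B] [DecidableEq A] (S D : Finset A) (f : A → B)
    (hsurj : ∀ y, ∃ x ∈ S, f x = y) (hD : D ⊆ S)
    (hne : ∀ x ∈ D, ∃ y ∈ S, y ≠ x ∧ f y = f x) :
    D.card + 2 * Fintype.card B ≤ 2 * S.card := by
  have h1 : S.card = ∑ y : B, (S.filter (fun x => f x = y)).card :=
    Finset.card_eq_sum_card_fiberwise (fun _ _ => Finset.mem_coe.mpr (Finset.mem_univ _))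
  have h2 : D.card = ∑ y : B, (D.filter (fun x => f x = y)).card :=
    Finset.card_eq_sum_card_fiberwise (fun _ _ => Finset.mem_coe.mpr (Finset.mem_univ _))
  have h3 : 2 * Fintype.card B = ∑ y : B, 2 := by simp [mul_comm]
  rw [h1, h2, h3, ← Finset.sum_add_distrib, Finset.mul_sum]
  apply Finset.sum_le_sum
  intro y _
  have hle : (D.filter (fun x => f x = y)).card ≤ (S.filter (fun x => f x = y)).card :=
    Finset.card_le_card (Finset.filter_subset_filter _ hD)
  have hpos : 0 < (S.filter (fun x => f x = y)).card := by
    obtain ⟨x, hx, hxy⟩ := hsurj y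
    exact Finset.card_pos.mpr ⟨x, by simp [hx, hxy]⟩
  by_cases h : (D.filter (fun x => f x = y)).card = 0
  · omega
  · obtain ⟨x, hx⟩ := Finset.card_pos.mp (Nat.pos_of_ne_zero h)
    rw [Finset.mem_filter] at hx
    obtain ⟨z, hz, hzx, hfz⟩ := hne x hx.1
    have : 1 < (S.filter (fun x => f x = y)).card := by
      rw [Finset.one_lt_card]
      exact ⟨x, by simp [hD hx.1, hx.2], z, by simp [hz, hfz, hx.2], hzx.symm⟩
    omega

/-- Exchange 1: an upper bound on the weight of the follower's tree. -/
lemma weight_le (T F M : SimpleGraph V) (hT : T.Connected) (c p : Sym2 V → ℝ) (a b : ℝ)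
    (hb : ∀ e ∈ T.edgeSet, c e ≤ b)
    (hM : IsSpanningTreeOf (T ⊔ F) M)
    (hmin : ∀ M' : SimpleGraph V, IsSpanningTreeOf (T ⊔ F) M' →
        weight T c p M ≤ weight T c p M') :
    weight T c p M ≤ (edg (low M (wt T c p) a)).card * a +
      ((edg M).card - (edg (low M (wt T c p) a)).card : ℝ) * b := by
  set L := low M (wt T c p) a with hL
  have hLM : L ≤ M := low_le _ _ _
  have hac : L.IsAcyclic := hM.2.isAcyclic.anti hLM
  have hconn : (L ⊔ T).Connected := hT.mono le_sup_right
  obtain ⟨N, hLN, hN, hNt⟩ := hconn.exists_isTree_le_of_le_of_isAcyclic le_sup_left hac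
  have h1 := hmin N ⟨hN.trans (sup_le (hLM.trans hM.1) le_sup_left), hNt⟩
  refine h1.trans ?_
  have hsub : edg L ⊆ edg N := by
    intro e; rw [mem_edg, mem_edg]; exact fun h => edgeSet_mono hLN h
  have hcard : (edg N).card = (edg M).card := by
    have := tree_card hNt; have := tree_card hM.2; omega
  rw [weight_eq, ← Finset.sum_sdiff hsub, add_comm]
  have hc2 : (((edg N) \ (edg L)).card : ℝ) = (edg M).card - (edg L).card := by
    rw [Finset.card_sdiff_of_subset hsub, Nat.cast_sub (Finset.card_le_card hsub), hcard]
  rw [← hc2]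
  apply add_le_add
  · rw [← nsmul_eq_mul]
    apply Finset.sum_le_card_nsmul
    intro e he
    rw [mem_edg, hL, mem_low] at he
    exact he.2
  · rw [← nsmul_eq_mul]
    apply Finset.sum_le_card_nsmul
    intro e he
    rw [Finset.mem_sdiff, mem_edg, mem_edg] at he
    have : e ∈ (L ⊔ T).edgeSet := edgeSet_mono hN he.1
    rw [edgeSet_sup] at this
    have hT' : e ∈ T.edgeSet := this.resolve_left he.2
    simp only [wt, hT', if_true]
    exact hb e hT'

/-- Exchange 2: endpoints of a cheap red edge are joined by cheap edges of `M`. -/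
lemma low_reachable (T F M : SimpleGraph V) (c p : Sym2 V → ℝ) (a : ℝ)
    (hM : IsSpanningTreeOf (T ⊔ F) M)
    (hmin : ∀ M' : SimpleGraph V, IsSpanningTreeOf (T ⊔ F) M' →
        weight T c p M ≤ weight T c p M') (u v : V) (huv : T.Adj u v) (hca : c s(u, v) ≤ a) :
    (low M (wt T c p) a).Reachable u v := by
  by_contra hr
  set L := low M (wt T c p) a with hL
  have hLM : L ≤ M := low_le _ _ _
  have hac : L.IsAcyclic := hM.2.isAcyclic.anti hLM
  have hac2 : (L ⊔ edge u v).IsAcyclic := hac.sup_edge_of_not_reachable hr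
  have hwe : wt T c p s(u, v) ≤ a := by
    have : s(u, v) ∈ T.edgeSet := huv
    simp only [wt, this, if_true]; exact hca
  have hnM : s(u, v) ∉ M.edgeSet := by
    intro h
    apply hr
    have : s(u, v) ∈ L.edgeSet := by rw [hL, mem_low]; exact ⟨h, hwe⟩
    exact Adj.reachable this
  have hconn : (M ⊔ edge u v).Connected := hM.2.connected.mono le_sup_left
  obtain ⟨N, hLN, hN, hNt⟩ := hconn.exists_isTree_le_of_le_of_isAcyclic
    (sup_le_sup_right hLM _) hac2
  have hedge : edge u v ≤ T := by
    rw [edge_le_iff]; right; exact huv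
  have h1 := hmin N ⟨hN.trans (sup_le hM.1 (hedge.trans le_sup_left)), hNt⟩
  have huvN : s(u, v) ∈ edg N := by
    rw [mem_edg]
    have : (edge u v).Adj u v := by rw [edge_adj]; exact ⟨Or.inl ⟨rfl, rfl⟩, huv.ne⟩
    exact hLN (Or.inr this)
  have hcard : (edg N).card = (edg M).card := by
    have := tree_card hNt; have := tree_card hM.2; omega
  have hsub : (edg N).erase s(u, v) ⊆ edg M := by
    intro e he
    rw [Finset.mem_erase, mem_edg] at he
    rw [mem_edg]
    have : e ∈ (M ⊔ edge u v).edgeSet := edgeSet_mono hN he.2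
    rw [edgeSet_sup] at this
    refine this.resolve_right ?_
    intro h
    rw [edgeSet_edge_of_ne huv.ne] at h
    exact he.1 h
  have hcd : (edg M \ (edg N).erase s(u, v)).card = 1 := by
    rw [Finset.card_sdiff_of_subset hsub, Finset.card_erase_of_mem huvN, hcard]
    have : 0 < (edg M).card := by rw [← hcard]; exact Finset.card_pos.mpr ⟨_, huvN⟩
    omega
  obtain ⟨f, hf⟩ := Finset.card_eq_one.mp hcd
  have hfm : f ∈ edg M \ (edg N).erase s(u, v) := by rw [hf]; simp
  rw [Finset.mem_sdiff, mem_edg] at hfm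
  have hfw : a < wt T c p f := by
    by_contra hle
    have hfL : f ∈ L.edgeSet := by rw [hL, mem_low]; exact ⟨hfm.1, not_lt.mp hle⟩
    apply hfm.2
    rw [Finset.mem_erase, mem_edg]
    refine ⟨?_, edgeSet_mono (le_sup_left.trans hLN) hfL⟩
    rintro rfl
    exact hnM hfm.1
  rw [weight_eq, weight_eq, ← Finset.sum_sdiff hsub, hf, ← Finset.add_sum_erase _ _ huvN] at h1
  simp only [Finset.sum_singleton] at h1
  linarith

end generic
end StackMST

namespace StackMST

open SimpleGraph Classical

section path

lemma pathEdge_mem (m : ℕ) (i : Fin m) : pathEdge m i ∈ (pathGraph (m + 1)).edgeSet := by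
  unfold pathEdge
  rw [mem_edgeSet, pathGraph_adj]
  left; simp

lemma pathEdge_eq (m : ℕ) (i : Fin m) (u v : Fin (m + 1)) (hu : (u : ℕ) = i)
    (hv : (v : ℕ) = i + 1) : pathEdge m i = s(u, v) := by
  have h1 : u = Fin.castSucc i := Fin.ext (by simpa using hu)
  have h2 : v = Fin.succ i := Fin.ext (by simpa using hv)
  rw [h1, h2]; rfl

lemma pathEdge_inj (m : ℕ) : Function.Injective (pathEdge m) := by
  intro i j h
  unfold pathEdge at h
  rw [Sym2.eq_iff] at h
  rcases h with h | h
  · exact Fin.castSucc_injective _ h.1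
  · have h1 := congrArg Fin.val h.1
    have h2 := congrArg Fin.val h.2
    simp at h1 h2
    omega

lemma pathEdge_surj (m : ℕ) (e : Sym2 (Fin (m + 1))) (he : e ∈ (pathGraph (m + 1)).edgeSet) :
    ∃ i, pathEdge m i = e := by
  induction e using Sym2.ind with
  | _ u v =>
    rw [mem_edgeSet, pathGraph_adj] at he
    rcases he with h | h
    · exact ⟨⟨u, by omega⟩, pathEdge_eq m _ u v rfl h.symm⟩
    · refine ⟨⟨v, by omega⟩, ?_⟩
      rw [Sym2.eq_swap]
      exact pathEdge_eq m _ v u rfl h.symm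

lemma redCost_eq (m : ℕ) (c : Sym2 (Fin (m + 1)) → ℝ) :
    redCost (pathGraph (m + 1)) c = ∑ i : Fin m, c (pathEdge m i) := by
  unfold redCost
  rw [esum_eq]
  symm
  apply Finset.sum_bij (fun i _ => pathEdge m i)
  · intro i _; simpa using pathEdge_mem m i
  · intro i _ j _ h; exact pathEdge_inj m h
  · intro e he
    obtain ⟨i, hi⟩ := pathEdge_surj m e (by simpa using he)
    exact ⟨i, Finset.mem_univ _, hi⟩
  · intros; rfl

/-- Indices of the edges of cost `a`. -/
noncomputable def aIdx (m : ℕ) (c : Sym2 (Fin (m + 1)) → ℝ) (a : ℝ) : Finset (Fin m) :=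
  Finset.univ.filter (fun i => c (pathEdge m i) = a)

lemma redCost_two (m : ℕ) (a b : ℝ) (c : Sym2 (Fin (m + 1)) → ℝ)
    (hc : ∀ e ∈ (pathGraph (m + 1)).edgeSet, c e = a ∨ c e = b) :
    redCost (pathGraph (m + 1)) c = (aIdx m c a).card * a + ((m : ℝ) - (aIdx m c a).card) * b := by
  rw [redCost_eq, ← Finset.sum_filter_add_sum_filter_not Finset.univ
    (fun i => c (pathEdge m i) = a)]
  have h1 : (Finset.univ.filter (fun i : Fin m => ¬ c (pathEdge m i) = a)).card
      + (aIdx m c a).card = m := by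
    have := Finset.card_filter_add_card_filter_not (s := (Finset.univ : Finset (Fin m)))
      (fun i => c (pathEdge m i) = a)
    simp only [Finset.card_univ, Fintype.card_fin] at this
    unfold aIdx; omega
  have h2 : ((Finset.univ.filter (fun i : Fin m => ¬ c (pathEdge m i) = a)).card : ℝ)
      = (m : ℝ) - (aIdx m c a).card := by
    rw [eq_sub_iff_add_eq]; exact_mod_cast h1
  rw [← h2]
  congr 1
  · rw [← nsmul_eq_mul]
    apply Finset.sum_eq_card_nsmul
    intro i hi; exact (Finset.mem_filter.mp hi).2
  · rw [← nsmul_eq_mul]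
    apply Finset.sum_eq_card_nsmul
    intro i hi
    exact (hc _ (pathEdge_mem m i)).resolve_left (Finset.mem_filter.mp hi).2

/-- Left ends of the components of the graph of cost-`a` red edges. -/
noncomputable def starts (m : ℕ) (c : Sym2 (Fin (m + 1)) → ℝ) (a : ℝ) : Finset (Fin (m + 1)) :=
  insert 0 ((Finset.univ.filter (fun i : Fin m => ¬ c (pathEdge m i) = a)).image Fin.succ)

lemma starts_card (m : ℕ) (c : Sym2 (Fin (m + 1)) → ℝ) (a : ℝ) :
    (starts m c a).card + (aIdx m c a).card ≤ m + 1 := by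
  have := Finset.card_filter_add_card_filter_not (s := (Finset.univ : Finset (Fin m)))
      (fun i => c (pathEdge m i) = a)
  simp only [Finset.card_univ, Fintype.card_fin] at this
  have h1 : (starts m c a).card ≤
      (Finset.univ.filter (fun i : Fin m => ¬ c (pathEdge m i) = a)).card + 1 :=
    (Finset.card_insert_le _ _).trans (Nat.succ_le_succ Finset.card_image_le)
  unfold aIdx; omega

lemma exists_start (m : ℕ) (c : Sym2 (Fin (m + 1)) → ℝ) (a : ℝ) (L : SimpleGraph (Fin (m + 1)))
    (hL : ∀ i : Fin m, c (pathEdge m i) = a → L.Reachable i.castSucc i.succ) :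
    ∀ (n : ℕ) (x : Fin (m + 1)), (x : ℕ) = n → ∃ v ∈ starts m c a, v ≤ x ∧ L.Reachable v x ∧
      ∀ i : Fin m, (v : ℕ) ≤ i → (i : ℕ) < x → c (pathEdge m i) = a := by
  intro n
  induction n with
  | zero =>
    intro x hx
    have : x = 0 := Fin.ext hx
    subst this
    refine ⟨0, by simp [starts], le_rfl, Reachable.refl _, ?_⟩
    intro i _ h; simp at h
  | succ n ih =>
    intro x hx
    have hnm : n < m := by omega
    let j : Fin m := ⟨n, hnm⟩
    have hxj : x = j.succ := Fin.ext (by simp [j, hx])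
    by_cases hj : c (pathEdge m j) = a
    · obtain ⟨v, hv, hvx, hr, hi⟩ := ih j.castSucc rfl
      refine ⟨v, hv, ?_, ?_, ?_⟩
      · rw [hxj]; exact hvx.trans (Fin.castSucc_lt_succ).le
      · rw [hxj]; exact hr.trans (hL j hj)
      · intro i h1 h2
        by_cases hin : (i : ℕ) = n
        · have : i = j := Fin.ext hin
          rw [this]; exact hj
        · apply hi i h1
          simp [j]; omega
    · refine ⟨x, ?_, le_rfl, Reachable.refl _, ?_⟩
      · rw [hxj]
        simp only [starts, Finset.mem_insert, Finset.mem_image, Finset.mem_filter]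
        right
        exact ⟨j, ⟨Finset.mem_univ _, hj⟩, rfl⟩
      · intro i h1 h2; omega

lemma block_unique (m : ℕ) (c : Sym2 (Fin (m + 1)) → ℝ) (a : ℝ) (l r l' r' i : Fin m)
    (h : IsABlock m c a l r) (h' : IsABlock m c a l' r') (h1 : l ≤ i) (h2 : i ≤ r)
    (h1' : l' ≤ i) (h2' : i ≤ r') : l = l' ∧ r = r' := by
  obtain ⟨-, hin, hl, hr⟩ := h
  obtain ⟨-, hin', hl', hr'⟩ := h'
  simp only [Fin.le_def] at *
  constructor
  · apply Fin.ext
    by_contra hne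
    rcases Nat.lt_or_gt_of_ne hne with hlt | hlt
    · have hlt2 : (l' : ℕ) - 1 < m := by omega
      exact hl' ⟨(l' : ℕ) - 1, hlt2⟩ (by simp; omega)
        (hin ⟨(l' : ℕ) - 1, hlt2⟩ (by simp; omega) (by simp; omega))
    · have hlt2 : (l : ℕ) - 1 < m := by omega
      exact hl ⟨(l : ℕ) - 1, hlt2⟩ (by simp; omega)
        (hin' ⟨(l : ℕ) - 1, hlt2⟩ (by simp; omega) (by simp; omega))
  · apply Fin.ext
    by_contra hne
    rcases Nat.lt_or_gt_of_ne hne with hlt | hlt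
    · have hlt2 : (r : ℕ) + 1 < m := by omega
      exact hr ⟨(r : ℕ) + 1, hlt2⟩ rfl
        (hin' ⟨(r : ℕ) + 1, hlt2⟩ (by simp; omega) (by simp; omega))
    · have hlt2 : (r' : ℕ) + 1 < m := by omega
      exact hr' ⟨(r' : ℕ) + 1, hlt2⟩ rfl
        (hin ⟨(r' : ℕ) + 1, hlt2⟩ (by simp; omega) (by simp; omega))

/-- The block `q` meets the tree `M` in a red edge. -/
def Hit (m : ℕ) (M : SimpleGraph (Fin (m + 1))) (q : Fin m × Fin m) : Prop :=
  ∃ i : Fin m, q.1 ≤ i ∧ i ≤ q.2 ∧ pathEdge m i ∈ M.edgeSet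

/-- The finset of bad blocks. -/
noncomputable def bad (m : ℕ) (c : Sym2 (Fin (m + 1)) → ℝ) (a : ℝ) : Finset (Fin m × Fin m) :=
  Finset.univ.filter (fun q => IsBadBlock m c a q.1 q.2)

lemma bad_card (m : ℕ) (c : Sym2 (Fin (m + 1)) → ℝ) (a : ℝ) :
    badBlockCount m c a = (bad m c a).card := by
  unfold badBlockCount bad
  rw [← Set.ncard_coe_finset]
  congr 1
  ext q; simp

lemma hit_le (m : ℕ) (c : Sym2 (Fin (m + 1)) → ℝ) (a : ℝ) (ha : 0 ≤ a)
    (hc : ∀ e ∈ (pathGraph (m + 1)).edgeSet, a ≤ c e) (M : SimpleGraph (Fin (m + 1))) :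
    (((bad m c a).filter (Hit m M)).card : ℝ) * a ≤
      esum c (M.edgeSet ∩ (pathGraph (m + 1)).edgeSet) := by
  rw [esum_red]
  set R := (edg M).filter (fun e => e ∈ (pathGraph (m + 1)).edgeSet) with hR
  have hcard : ((bad m c a).filter (Hit m M)).card ≤ R.card := by
    have hch : ∀ q : Fin m × Fin m, ∃ e : Sym2 (Fin (m + 1)), q ∈ (bad m c a).filter (Hit m M) →
        ∃ i : Fin m, q.1 ≤ i ∧ i ≤ q.2 ∧ pathEdge m i ∈ M.edgeSet ∧ e = pathEdge m i := by
      intro q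
      by_cases h : q ∈ (bad m c a).filter (Hit m M)
      · obtain ⟨i, h1, h2, h3⟩ := (Finset.mem_filter.mp h).2
        exact ⟨pathEdge m i, fun _ => ⟨i, h1, h2, h3, rfl⟩⟩
      · exact ⟨s(0, 0), fun h' => absurd h' h⟩
    choose f hf using hch
    apply Finset.card_le_card_of_injOn f
    · intro q hq
      obtain ⟨i, h1, h2, h3, h4⟩ := hf q hq
      rw [hR, Finset.mem_coe, Finset.mem_filter, mem_edg, h4]
      exact ⟨h3, pathEdge_mem m i⟩
    · intro q hq q' hq' heq
      obtain ⟨i, h1, h2, h3, h4⟩ := hf q hq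
      obtain ⟨i', h1', h2', h3', h4'⟩ := hf q' hq'
      have hii : i = i' := pathEdge_inj m (by rw [← h4, ← h4', heq])
      subst hii
      have hb := (Finset.mem_filter.mp (Finset.mem_filter.mp hq).1).2
      have hb' := (Finset.mem_filter.mp (Finset.mem_filter.mp hq').1).2
      have := block_unique m c a _ _ _ _ i hb.1 hb'.1 h1 h2 h1' h2'
      exact Prod.ext this.1 this.2
  have h1 : (R.card : ℝ) * a ≤ ∑ e ∈ R, c e := by
    rw [← nsmul_eq_mul]
    apply Finset.card_nsmul_le_sum
    intro e he
    exact hc e (Finset.mem_filter.mp he).2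
  refine le_trans ?_ h1
  exact mul_le_mul_of_nonneg_right (by exact_mod_cast hcard) ha

lemma first_step {V : Type*} {G : SimpleGraph V} {u v : V} (h : G.Reachable u v) (hne : u ≠ v) :
    ∃ y, G.Adj u y ∧ G.Reachable y v := by
  obtain ⟨wk⟩ := h
  cases wk with
  | nil => exact absurd rfl hne
  | cons hadj wk' => exact ⟨_, hadj, wk'.reachable⟩

lemma unhit_count (m : ℕ) (c : Sym2 (Fin (m + 1)) → ℝ) (a : ℝ) (M L : SimpleGraph (Fin (m + 1)))
    (hLM : L ≤ M)
    (hL : ∀ i : Fin m, c (pathEdge m i) = a → L.Reachable i.castSucc i.succ) :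
    ((bad m c a).filter (fun q => ¬ Hit m M q)).card + 2 * (aIdx m c a).card
      ≤ 2 * (edg L).card := by
  set B := (bad m c a).filter (fun q => ¬ Hit m M q) with hB
  set D : Finset (Fin (m + 1)) := B.image (fun q => q.1.castSucc) with hD
  have hbad : ∀ q ∈ B, IsBadBlock m c a q.1 q.2 ∧ ¬ Hit m M q := by
    intro q hq
    rw [hB, Finset.mem_filter] at hq
    exact ⟨(Finset.mem_filter.mp hq.1).2, hq.2⟩
  have hDc : D.card = B.card := by
    apply Finset.card_image_of_injOn
    intro q hq q' hq' heq
    have hl : q.1 = q'.1 := Fin.castSucc_injective _ heq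
    have h1 := (hbad q hq).1.1
    have h2 := (hbad q' hq').1.1
    have := block_unique m c a _ _ _ _ q.1 h1 h2 le_rfl h1.1 hl.ge (hl ▸ h2.1)
    exact Prod.ext this.1 this.2
  have hDS : D ⊆ starts m c a := by
    intro x hx
    obtain ⟨q, hq, rfl⟩ := Finset.mem_image.mp hx
    have h1 := (hbad q hq).1.1
    by_cases h0 : (q.1 : ℕ) = 0
    · have : q.1.castSucc = (0 : Fin (m + 1)) := Fin.ext (by simpa using h0)
      simp [starts, this]
    · have hlt : (q.1 : ℕ) - 1 < m := by omega
      simp only [starts, Finset.mem_insert, Finset.mem_image, Finset.mem_filter]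
      right
      refine ⟨⟨(q.1 : ℕ) - 1, hlt⟩, ⟨Finset.mem_univ _, ?_⟩, ?_⟩
      · exact h1.2.2.1 _ (by simp; omega)
      · apply Fin.ext; simp; omega
  have hsurj : ∀ y : L.ConnectedComponent, ∃ x ∈ starts m c a, L.connectedComponentMk x = y := by
    intro y
    induction y using ConnectedComponent.ind with
    | _ x =>
      obtain ⟨v, hv, -, hr, -⟩ := exists_start m c a L hL x x rfl
      exact ⟨v, hv, ConnectedComponent.sound hr⟩
  have hne : ∀ x ∈ D, ∃ y ∈ starts m c a, y ≠ x ∧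
      L.connectedComponentMk y = L.connectedComponentMk x := by
    intro x hx
    obtain ⟨q, hq, rfl⟩ := Finset.mem_image.mp hx
    obtain ⟨⟨hblk, hlen⟩, hnh⟩ := hbad q hq
    obtain ⟨hlr, hin, hl, hr⟩ := hblk
    by_contra hcon
    push Not at hcon
    have key : ∀ z, L.Reachable q.1.castSucc z → (q.1 : ℕ) ≤ z ∧ (z : ℕ) ≤ q.2 + 1 := by
      intro z hz
      obtain ⟨v, hv, hvz, hrv, hva⟩ := exists_start m c a L hL z z rfl
      have hvq : v = q.1.castSucc := by
        by_contra hvne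
        exact hcon v hv hvne (ConnectedComponent.sound (hrv.trans hz.symm))
      subst hvq
      refine ⟨by simpa [Fin.le_def] using hvz, ?_⟩
      by_contra hgt
      have hlt : (q.2 : ℕ) + 1 < m := by omega
      refine hr ⟨(q.2 : ℕ) + 1, hlt⟩ rfl (hva _ ?_ ?_)
      · have : (q.1 : ℕ) ≤ q.2 := hlr
        simp; omega
      · simp; omega
    have hr1 : L.Reachable q.1.castSucc q.1.succ := hL q.1 (hin q.1 le_rfl hlr)
    obtain ⟨y, hadj, hyr⟩ := first_step hr1.symm
      (by intro h; have := congrArg Fin.val h; simp at this)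
    have hy := key y hyr.symm
    have hM : M.Adj q.1.succ y := hLM hadj
    have hyne : (y : ℕ) ≠ q.1 + 1 := by
      intro h
      exact hM.ne (Fin.ext (by simp [h]))
    apply hnh
    have hcases : (y : ℕ) = q.1 ∨ ((y : ℕ) = q.1 + 2 ∧ (q.2 : ℕ) = q.1 + 1) := by omega
    rcases hcases with h | ⟨h, h'⟩
    · refine ⟨q.1, le_rfl, hlr, ?_⟩
      rw [pathEdge_eq m q.1 y q.1.succ h (by simp)]
      exact hM.symm
    · refine ⟨q.2, hlr, le_rfl, ?_⟩
      rw [pathEdge_eq m q.2 q.1.succ y (by simp [h']) (by omega)]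
      exact hM
  have h1 := fiber_count (starts m c a) D L.connectedComponentMk hsurj hDS hne
  have h2 := starts_card m c a
  have h3 := card_comp L
  rw [Fintype.card_fin] at h3
  simp only [← Nat.card_eq_fintype_card] at h1 h3
  omega

lemma bound_arith (a b : ℝ) (ha : 0 ≤ a) (hab : a < b) (s t σ d : ℕ) (hσ : t + s = σ)
    (hd : s ≤ 2 * d) : twoCostBound a b σ ≤ t * a + d * (b - a) := by
  have hσ' : (t : ℝ) + s = σ := by exact_mod_cast hσ
  have hd' : (s : ℝ) ≤ 2 * d := by exact_mod_cast hd
  have ht0 : (0 : ℝ) ≤ t := Nat.cast_nonneg t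
  have hd0 : (0 : ℝ) ≤ d := Nat.cast_nonneg d
  unfold twoCostBound
  by_cases h : 2 * a ≤ b - a
  · refine (min_le_left _ _).trans ?_
    nlinarith [mul_le_mul_of_nonneg_left h hd0, mul_le_mul_of_nonneg_right hd' ha]
  · rw [not_le] at h
    refine (min_le_right _ _).trans ?_
    have hba : 0 ≤ b - a := by linarith
    rcases Nat.even_or_odd' σ with ⟨k, hk | hk⟩
    · have hk2 : σ / 2 = k := by omega
      have hkr : (σ : ℝ) = 2 * k := by exact_mod_cast hk
      rw [hk2, hkr]
      have h1 : (2 * k : ℝ) ≤ t + 2 * d := by linarith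
      nlinarith [mul_le_mul_of_nonneg_right h1 hba, mul_le_mul_of_nonneg_left h.le ht0]
    · have hk2 : σ / 2 = k := by omega
      have hkr : (σ : ℝ) = 2 * k + 1 := by exact_mod_cast hk
      rw [hk2, hkr]
      have e1 : (2 * (k : ℝ) + 1 - 2 * k) = 1 := by ring
      rw [e1, one_mul]
      by_cases ht : t = 0
      · have h1 : k + 1 ≤ d := by omega
        have h2 : (k : ℝ) + 1 ≤ d := by exact_mod_cast h1
        have h3 := min_le_right a (b - a)
        subst ht
        push_cast
        nlinarith [mul_le_mul_of_nonneg_right h2 hba]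
      · have h1 : 1 ≤ t := Nat.one_le_iff_ne_zero.mpr ht
        have h2 : (0 : ℝ) ≤ (t : ℝ) - 1 := by
          have : (1 : ℝ) ≤ t := by exact_mod_cast h1
          linarith
        have h3 := min_le_left a (b - a)
        have h4 : (2 * k : ℝ) ≤ (t - 1) + 2 * d := by linarith
        nlinarith [mul_le_mul_of_nonneg_right h4 hba, mul_le_mul_of_nonneg_left h.le h2]

lemma tree_bound (m : ℕ) (a b : ℝ) (ha : 0 ≤ a) (hab : a < b)
    (c : Sym2 (Fin (m + 1)) → ℝ)
    (hc : ∀ e ∈ (pathGraph (m + 1)).edgeSet, c e = a ∨ c e = b)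
    (F M : SimpleGraph (Fin (m + 1))) (p : Sym2 (Fin (m + 1)) → ℝ)
    (hM : IsSpanningTreeOf (pathGraph (m + 1) ⊔ F) M)
    (hmin : ∀ M' : SimpleGraph (Fin (m + 1)), IsSpanningTreeOf (pathGraph (m + 1) ⊔ F) M' →
        weight (pathGraph (m + 1)) c p M ≤ weight (pathGraph (m + 1)) c p M') :
    blueRevenue (pathGraph (m + 1)) p M ≤
      redCost (pathGraph (m + 1)) c - twoCostBound a b (badBlockCount m c a) := by
  set T := pathGraph (m + 1) with hT
  set L := low M (wt T c p) a with hLdef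
  have hw := weight_le T F M (pathGraph_connected m) c p a b
    (fun e he => by rcases hc e he with h | h <;> rw [h]; exact hab.le) hM hmin
  have hL : ∀ i : Fin m, c (pathEdge m i) = a → L.Reachable i.castSucc i.succ := by
    intro i hi
    exact low_reachable T F M c p a hM hmin _ _ (pathEdge_mem m i) (le_of_eq hi)
  have hcount := unhit_count m c a M L (low_le _ _ _) hL
  have hhit := hit_le m c a ha
    (fun e he => by rcases hc e he with h | h <;> rw [h]; exact hab.le) M
  have hred := redCost_two m a b c hc
  have hcard : (edg M).card = m := by
    have := tree_card hM.2
    rw [Fintype.card_fin] at this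
    omega
  have hsplit := Finset.card_filter_add_card_filter_not (s := bad m c a) (Hit m M)
  rw [← bad_card] at hsplit
  have hd : (aIdx m c a).card ≤ (edg L).card := by omega
  have harith := bound_arith a b ha hab _ _ _ ((edg L).card - (aIdx m c a).card) hsplit (by omega)
  rw [Nat.cast_sub hd] at harith
  rw [hcard] at hw
  have hwdef : weight T c p M = esum c (M.edgeSet ∩ T.edgeSet) + blueRevenue T p M := rfl
  rw [← hT] at hred hhit
  rw [hred]
  nlinarith

end path
end StackMST
open StackMST

/-- For the StackMST(0,0) game whose red tree is a path all of
whose edge costs lie in `{a, b}` with `0 ≤ a < b`, and where `σ` is the number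
of bad `a`-blocks of the path, the optimal revenue satisfies
`r* ≤ c(P) − min{σa, ⌊σ/2⌋(b−a) + (σ − 2⌊σ/2⌋)·min{a, b−a}}`. -/
theorem stackMST_path_twoCosts_upperBound
    (m : ℕ) (hm : 1 ≤ m) (a b : ℝ) (ha : 0 ≤ a) (hab : a < b)
    (c : Sym2 (Fin (m + 1)) → ℝ)
    (hc : ∀ e ∈ (SimpleGraph.pathGraph (m + 1)).edgeSet, c e = a ∨ c e = b) :
    optRevenue (SimpleGraph.pathGraph (m + 1)) c ≤
      redCost (SimpleGraph.pathGraph (m + 1)) c - twoCostBound a b (badBlockCount m c a) := by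
  apply csSup_le
  · exact ⟨_, ⊥, 0, bot_le, by simp, rfl⟩
  · rintro r ⟨F, p, -, -, rfl⟩
    apply csSup_le
    · obtain ⟨N, hN, hNt⟩ := (SimpleGraph.pathGraph_connected m).exists_isTree_le
      obtain ⟨M, hM, hmin⟩ := Set.exists_min_image
        {M : SimpleGraph (Fin (m + 1)) | IsSpanningTreeOf (SimpleGraph.pathGraph (m + 1) ⊔ F) M}
        (weight (SimpleGraph.pathGraph (m + 1)) c p) (Set.toFinite _)
        ⟨N, hN.trans le_sup_left, hNt⟩
      exact ⟨_, M, hM, hmin, rfl⟩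
    · rintro r ⟨M, hM, hmin, rfl⟩
      exact tree_bound m a b ha hab c hc F M p hM hmin
end

section
/- Let h, k ≥ 1 and let x_1, …, x_{2h} and y_1, …, y_{2k} be nonnegative real numbers. Define r1 = Σ_{i=1}^{h} max{x_{2i−1}, x_{2i}} + Σ_{i=1}^{k} max{y_{2i−1}, y_{2i}}; r2 = Σ_{i=1}^{h} min{x_{2i−1}, x_{2i}} + Σ_{i=1}^{k} min{y_{2i−1}, y_{2i}} + x_1 + y_{2k} + Σ_{i=0}^{h−2} min{x_{2i+2}, x_{2i+3}} + Σ_{i=0}^{k−2} min{y_{2i+2}, y_{2i+3}}; and r3 = x_{2h} + y_1 + Σ_{i=0}^{h−2} max{x_{2i+2}, x_{2i+3}} + Σ_{i=0}^{k−2} max{y_{2i+2}, y_{2i+3}}. Then r1 + r2 + r3 = 2·(Σ_{i=1}^{2h} x_i + Σ_{j=1}^{2k} y_j), and consequently max{r1, r2, r3} ≥ (2/3)·(Σ_{i=1}^{2h} x_i + Σ_{j=1}^{2k} y_j). -/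
theorem aux_pairs (x : ℕ → ℝ) (n : ℕ) :
    (∑ i ∈ Finset.Icc 1 (n + 1), max (x (2 * i - 1)) (x (2 * i))) +
    (∑ i ∈ Finset.Icc 1 (n + 1), min (x (2 * i - 1)) (x (2 * i))) =
      ∑ i ∈ Finset.Icc 1 (2 * (n + 1)), x i ∧
    x 1 + x (2 * (n + 1)) +
    (∑ i ∈ Finset.range n, max (x (2 * i + 2)) (x (2 * i + 3))) +
    (∑ i ∈ Finset.range n, min (x (2 * i + 2)) (x (2 * i + 3))) =
      ∑ i ∈ Finset.Icc 1 (2 * (n + 1)), x i := by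
  induction n with
  | zero =>
    have e : Finset.Icc 1 (2 * (0 + 1)) = {1, 2} := by decide
    rw [e]
    simp [max_add_min]
  | succ n ih =>
    obtain ⟨h1, h2⟩ := ih
    have e : ∑ i ∈ Finset.Icc 1 (2 * (n + 1 + 1)), x i =
        ∑ i ∈ Finset.Icc 1 (2 * (n + 1)), x i + x (2 * n + 3) + x (2 * n + 4) := by
      rw [show 2 * (n + 1 + 1) = 2 * (n + 1) + 1 + 1 by ring,
        Finset.sum_Icc_succ_top (by omega), Finset.sum_Icc_succ_top (by omega)]
      rfl
    have m1 := max_add_min (x (2 * n + 3)) (x (2 * n + 4))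
    have m2 := max_add_min (x (2 * n + 2)) (x (2 * n + 3))
    have e1 : 2 * (n + 1 + 1) - 1 = 2 * n + 3 := by omega
    have e2 : 2 * (n + 1 + 1) = 2 * n + 4 := by omega
    have e3 : x (2 * (n + 1)) = x (2 * n + 2) := rfl
    rw [e]
    constructor
    · rw [Finset.sum_Icc_succ_top (b := n + 1) (by omega) (fun i => max (x (2 * i - 1)) (x (2 * i))),
        Finset.sum_Icc_succ_top (b := n + 1) (by omega) (fun i => min (x (2 * i - 1)) (x (2 * i))), e1, e2]
      linarith
    · rw [Finset.sum_range_succ, Finset.sum_range_succ, e2]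
      linarith

/-- Let `h, k ≥ 1` and let `x 1, …, x (2h)` and `y 1, …, y (2k)` be
nonnegative reals. With `r1`, `r2`, `r3` the revenues of the three candidate
solutions of the `(3/2 + ε)`-approximation algorithm, one has
`r1 + r2 + r3 = 2 (Σ x + Σ y)` and hence `max{r1, r2, r3} ≥ (2/3)(Σ x + Σ y)`. -/
theorem three_solutions_identity (h k : ℕ) (hh : 1 ≤ h) (hk : 1 ≤ k)
    (x y : ℕ → ℝ)
    (hx : ∀ i ∈ Finset.Icc 1 (2 * h), 0 ≤ x i)
    (hy : ∀ j ∈ Finset.Icc 1 (2 * k), 0 ≤ y j)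
    (r1 r2 r3 : ℝ)
    (hr1 : r1 = (∑ i ∈ Finset.Icc 1 h, max (x (2 * i - 1)) (x (2 * i))) +
      (∑ i ∈ Finset.Icc 1 k, max (y (2 * i - 1)) (y (2 * i))))
    (hr2 : r2 = (∑ i ∈ Finset.Icc 1 h, min (x (2 * i - 1)) (x (2 * i))) +
      (∑ i ∈ Finset.Icc 1 k, min (y (2 * i - 1)) (y (2 * i))) +
      x 1 + y (2 * k) +
      (∑ i ∈ Finset.range (h - 1), min (x (2 * i + 2)) (x (2 * i + 3))) +
      (∑ i ∈ Finset.range (k - 1), min (y (2 * i + 2)) (y (2 * i + 3))))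
    (hr3 : r3 = x (2 * h) + y 1 +
      (∑ i ∈ Finset.range (h - 1), max (x (2 * i + 2)) (x (2 * i + 3))) +
      (∑ i ∈ Finset.range (k - 1), max (y (2 * i + 2)) (y (2 * i + 3)))) :
    r1 + r2 + r3 =
      2 * ((∑ i ∈ Finset.Icc 1 (2 * h), x i) + (∑ j ∈ Finset.Icc 1 (2 * k), y j)) ∧
    (2 / 3 : ℝ) * ((∑ i ∈ Finset.Icc 1 (2 * h), x i) + (∑ j ∈ Finset.Icc 1 (2 * k), y j)) ≤
      max r1 (max r2 r3) := by
  obtain ⟨m, rfl⟩ : ∃ m, h = m + 1 := ⟨h - 1, by omega⟩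
  obtain ⟨n, rfl⟩ : ∃ n, k = n + 1 := ⟨k - 1, by omega⟩
  obtain ⟨a1, a2⟩ := aux_pairs x m
  obtain ⟨b1, b2⟩ := aux_pairs y n
  simp only [Nat.add_sub_cancel] at hr2 hr3
  have key : r1 + r2 + r3 =
      2 * ((∑ i ∈ Finset.Icc 1 (2 * (m + 1)), x i) +
        (∑ j ∈ Finset.Icc 1 (2 * (n + 1)), y j)) := by
    linarith
  refine ⟨key, ?_⟩
  have l1 : r1 ≤ max r1 (max r2 r3) := le_max_left _ _
  have l2 : r2 ≤ max r1 (max r2 r3) := (le_max_left _ _).trans (le_max_right _ _)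
  have l3 : r3 ≤ max r1 (max r2 r3) := (le_max_right _ _).trans (le_max_right _ _)
  linarith
end

section
/- For the StackMST(0,0) game whose red tree is a path P on n ≥ 6 vertices with nonnegative edge costs, the optimal revenue satisfies r*(P, c) ≥ c(P) / (3/2 + 9/(2n − 10)). -/
open StackMST

set_option linter.unusedSimpArgs false

/-- The finset of elements of a set of edges. -/
noncomputable def SM_fs {n : ℕ} (S : Set (Sym2 (Fin n))) : Finset (Sym2 (Fin n)) :=
  (Set.toFinite S).toFinset

theorem SM_mem_fs {n : ℕ} (S : Set (Sym2 (Fin n))) (e : Sym2 (Fin n)) : e ∈ SM_fs S ↔ e ∈ S := by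
  simp [SM_fs]

/-- A finite `esum` is a finset sum. -/
theorem SM_esum_eq {n : ℕ} (w : Sym2 (Fin n) → ℝ) (s : Set (Sym2 (Fin n))) :
    esum w s = ∑ e ∈ SM_fs s, w e :=
  finsum_mem_eq_finite_toFinset_sum _ _

open Classical in
/-- The combined weight of an edge. -/
noncomputable def SM_w {n : ℕ} (T : SimpleGraph (Fin n)) (c p : Sym2 (Fin n) → ℝ)
    (e : Sym2 (Fin n)) : ℝ := if e ∈ T.edgeSet then c e else p e

open Classical in
theorem SM_weight_eq {n : ℕ} (T : SimpleGraph (Fin n)) (c p : Sym2 (Fin n) → ℝ)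
    (M : SimpleGraph (Fin n)) :
    weight T c p M = ∑ e ∈ SM_fs M.edgeSet, SM_w T c p e := by
  unfold weight
  rw [SM_esum_eq, SM_esum_eq,
    ← Finset.sum_filter_add_sum_filter_not (SM_fs M.edgeSet) (fun e => e ∈ T.edgeSet)
      (SM_w T c p)]
  congr 1
  · apply Finset.sum_congr
    · ext e; simp [SM_mem_fs]
    · intro e he
      simp only [SM_mem_fs, Finset.mem_filter] at he
      simp [SM_w, he.2]
  · apply Finset.sum_congr
    · ext e; simp [SM_mem_fs]
    · intro e he
      simp only [SM_mem_fs, Finset.mem_filter] at he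
      simp [SM_w, he.2]

theorem SM_follower_le {n : ℕ} (T : SimpleGraph (Fin n)) (hT : T.IsTree) (c : Sym2 (Fin n) → ℝ)
    (hc : ∀ e ∈ T.edgeSet, 0 ≤ c e) (F : SimpleGraph (Fin n)) (p : Sym2 (Fin n) → ℝ)
    (M : SimpleGraph (Fin n))
    (hmin : ∀ M' : SimpleGraph (Fin n), IsSpanningTreeOf (T ⊔ F) M' →
        weight T c p M ≤ weight T c p M') :
    blueRevenue T p M ≤ redCost T c := by
  classical
  have h1 := hmin T ⟨le_sup_left, hT⟩
  unfold weight at h1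
  have h2 : 0 ≤ esum c (M.edgeSet ∩ T.edgeSet) := by
    rw [SM_esum_eq]
    apply Finset.sum_nonneg
    intro e he
    simp only [SM_mem_fs, Finset.mem_filter] at he
    exact hc e he.2
  have h3 : esum p (T.edgeSet \ T.edgeSet) = 0 := by
    rw [SM_esum_eq]; simp [SM_fs]
  rw [h3, Set.inter_self] at h1
  unfold blueRevenue redCost
  linarith

theorem SM_redCost_nonneg {n : ℕ} (T : SimpleGraph (Fin n)) (c : Sym2 (Fin n) → ℝ)
    (hc : ∀ e ∈ T.edgeSet, 0 ≤ c e) : 0 ≤ redCost T c := by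
  classical
  unfold redCost
  rw [SM_esum_eq]
  apply Finset.sum_nonneg
  intro e he
  simp only [SM_mem_fs, Finset.mem_filter] at he
  exact hc e he

theorem SM_le_opt {n : ℕ} (T : SimpleGraph (Fin n)) (hT : T.IsTree) (c : Sym2 (Fin n) → ℝ)
    (hc : ∀ e ∈ T.edgeSet, 0 ≤ c e) (F : SimpleGraph (Fin n)) (p : Sym2 (Fin n) → ℝ)
    (hF : IsBlueSet T F) (hp : ∀ e ∈ F.edgeSet, 0 ≤ p e)
    (M : SimpleGraph (Fin n)) (hM : IsSpanningTreeOf (T ⊔ F) M)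
    (hmin : ∀ M' : SimpleGraph (Fin n), IsSpanningTreeOf (T ⊔ F) M' →
        weight T c p M ≤ weight T c p M') :
    blueRevenue T p M ≤ optRevenue T c := by
  have hb : ∀ F p, followerRevenue T c F p ≤ redCost T c := by
    intro F p
    apply Real.sSup_le _ (SM_redCost_nonneg T c hc)
    rintro r ⟨M, _, h2, rfl⟩
    exact SM_follower_le T hT c hc F p M h2
  calc blueRevenue T p M ≤ followerRevenue T c F p := by
        apply le_csSup
        · refine ⟨redCost T c, ?_⟩
          rintro r ⟨M, _, h2, rfl⟩
          exact SM_follower_le T hT c hc F p M h2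
        · exact ⟨M, hM, hmin, rfl⟩
    _ ≤ optRevenue T c := by
        apply le_csSup
        · refine ⟨redCost T c, ?_⟩
          rintro r ⟨F, p, _, _, rfl⟩
          exact hb F p
        · exact ⟨F, p, hF, hp, rfl⟩

open Classical in
/-- Core lemma: a strategy whose tree is given as an indexed family of edges. -/
theorem SM_core {n : ℕ} (T : SimpleGraph (Fin n)) (hT : T.IsTree) (c : Sym2 (Fin n) → ℝ)
    (hc : ∀ e ∈ T.edgeSet, 0 ≤ c e) (F : SimpleGraph (Fin n)) (p : Sym2 (Fin n) → ℝ)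
    (hF : IsBlueSet T F) (hp : ∀ e ∈ F.edgeSet, 0 ≤ p e)
    {ι : Type} [DecidableEq ι] (s : Finset ι) (hs : s.card + 1 = n) (g : ι → Sym2 (Fin n))
    (hg : ∀ i ∈ s, g i ∈ (T ⊔ F).edgeSet)
    (hconn : (SimpleGraph.fromEdgeSet (g '' s)).Connected)
    (hlb : ∀ M' : SimpleGraph (Fin n), M' ≤ T ⊔ F → M'.Connected →
      ∑ i ∈ s, SM_w T c p (g i) ≤ ∑ e ∈ SM_fs M'.edgeSet, SM_w T c p e) :
    ∑ i ∈ s with g i ∉ T.edgeSet, SM_w T c p (g i) ≤ optRevenue T c := by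
  set M := SimpleGraph.fromEdgeSet (g '' s) with hMdef
  have hw : ∀ e ∈ (T ⊔ F).edgeSet, 0 ≤ SM_w T c p e := by
    intro e he
    unfold SM_w
    split_ifs with h
    · exact hc e h
    · apply hp
      rw [SimpleGraph.edgeSet_sup] at he
      exact he.resolve_left h
  have hMle : M ≤ T ⊔ F := by
    intro x y hxy
    rw [hMdef, SimpleGraph.fromEdgeSet_adj] at hxy
    obtain ⟨i, hi, h⟩ := hxy.1
    have := hg i hi
    rwa [h] at this
  have hMe : ∀ e ∈ M.edgeSet, ∃ i ∈ s, g i = e := by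
    intro e he
    rw [hMdef, SimpleGraph.edgeSet_fromEdgeSet] at he
    obtain ⟨i, hi, h⟩ := he.1
    exact ⟨i, hi, h⟩
  have hMtree : M.IsTree := by
    rw [SimpleGraph.isTree_iff_connected_and_card]
    refine ⟨hconn, ?_⟩
    have h1 := hconn.card_vert_le_card_edgeSet_add_one
    refine le_antisymm ?_ h1
    have : Nat.card M.edgeSet ≤ s.card := by
      have h2 : M.edgeSet ⊆ (s.image g : Finset _) := by
        intro e he
        obtain ⟨i, hi, h⟩ := hMe e he
        simp only [Finset.coe_image]
        exact ⟨i, hi, h⟩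
      have h3 := Set.ncard_le_ncard h2 (Set.toFinite _)
      rw [Set.ncard_coe_finset] at h3
      exact h3.trans Finset.card_image_le
    simp only [Nat.card_eq_fintype_card, Fintype.card_fin] at this ⊢
    omega
  have hsum : ∀ P : Sym2 (Fin n) → Prop, ∑ e ∈ SM_fs {e | e ∈ M.edgeSet ∧ P e}, SM_w T c p e ≤
      ∑ i ∈ s with P (g i), SM_w T c p (g i) := by
    intro P
    calc ∑ e ∈ SM_fs {e | e ∈ M.edgeSet ∧ P e}, SM_w T c p e
        ≤ ∑ e ∈ (s.filter (fun i => P (g i))).image g, SM_w T c p e := by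
          apply Finset.sum_le_sum_of_subset_of_nonneg
          · intro e he
            simp only [SM_mem_fs, Finset.mem_filter, Finset.mem_univ, true_and] at he
            obtain ⟨i, hi, h⟩ := hMe e he.1
            simp only [Finset.mem_image, Finset.mem_filter]
            exact ⟨i, ⟨hi, h ▸ he.2⟩, h⟩
          · intro e he _
            simp only [Finset.mem_image, Finset.mem_filter] at he
            obtain ⟨i, ⟨hi, _⟩, rfl⟩ := he
            exact hw _ (hg i hi)
      _ ≤ _ := by
          apply Finset.sum_image_le_of_nonneg
          intro e he
          obtain ⟨i, hi, rfl⟩ := Finset.mem_image.mp he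
          exact hw _ (hg _ (Finset.mem_filter.mp hi).1)
  have hWle : weight T c p M ≤ ∑ i ∈ s, SM_w T c p (g i) := by
    rw [SM_weight_eq]
    have := hsum (fun _ => True)
    simpa [SM_fs] using this
  have hWge : ∑ i ∈ s, SM_w T c p (g i) ≤ weight T c p M := by
    rw [SM_weight_eq]
    exact hlb M hMle hconn
  have hopt := SM_le_opt T hT c hc F p hF hp M ⟨hMle, hMtree⟩ (by
    intro M' hM'
    refine hWle.trans ?_
    rw [SM_weight_eq]
    exact hlb M' hM'.1 hM'.2.1)
  refine le_trans ?_ hopt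
  have hred : esum c (M.edgeSet ∩ T.edgeSet) ≤ ∑ i ∈ s with g i ∈ T.edgeSet, SM_w T c p (g i) := by
    have hs2 := hsum (fun e => e ∈ T.edgeSet)
    refine le_trans (le_of_eq ?_) (le_trans hs2 (le_of_eq (by congr!)))
    rw [SM_esum_eq]
    apply Finset.sum_congr
    · ext e; simp [SM_mem_fs]
    · intro e he
      simp only [SM_mem_fs, Set.mem_inter_iff] at he
      simp [SM_w, he.2]
  have hsplit := Finset.sum_filter_add_sum_filter_not s (fun i => g i ∈ T.edgeSet)
    (fun i => SM_w T c p (g i))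
  unfold weight at hWge
  unfold blueRevenue
  linarith

/-- Rooting a connected graph: distinct edges for the non-root vertices. -/
theorem SM_parent {n : ℕ} (M : SimpleGraph (Fin n)) (hM : M.Connected) (v : Fin n) :
    ∃ f : Fin n → Fin n, (∀ u, u ≠ v → M.Adj u (f u)) ∧
      Set.InjOn (fun u => s(u, f u)) {u | u ≠ v} := by
  have h : ∀ u, ∃ x, u ≠ v → (M.Adj u x ∧ M.dist x v < M.dist u v) := by
    intro u
    by_cases huv : u = v
    · exact ⟨u, fun h => absurd huv h⟩
    · obtain ⟨q, hq⟩ := hM.exists_walk_length_eq_dist u v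
      cases q with
      | nil => exact absurd rfl huv
      | @cons _ x _ hadj q' =>
        refine ⟨x, fun _ => ⟨hadj, ?_⟩⟩
        have := SimpleGraph.dist_le q'
        simp only [SimpleGraph.Walk.length_cons] at hq
        omega
  choose f hf using h
  refine ⟨f, fun u hu => (hf u hu).1, ?_⟩
  intro u hu u' hu' he
  simp only [Sym2.eq_iff] at he
  rcases he with he | he
  · exact he.1
  · have h1 := (hf u hu).2
    have h2 := (hf u' hu').2
    rw [he.2] at h1
    rw [← he.1] at h2
    omega

open Classical in
/-- Star strategy. -/
theorem SM_star {n : ℕ} (T : SimpleGraph (Fin n)) (hT : T.IsTree) (c : Sym2 (Fin n) → ℝ)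
    (hc : ∀ e ∈ T.edgeSet, 0 ≤ c e) (t : Fin n → Fin n) (ht : ∀ u, T.Adj u (t u))
    (htri : ∀ x y z, T.Adj x y → T.Adj y z → ¬ T.Adj x z)
    (htmin : ∀ u x, T.Adj u x → c s(u, t u) ≤ c s(u, x)) (v : Fin n) :
    ∑ u with (u ≠ v ∧ ¬ T.Adj u v), c s(u, t u) ≤ optRevenue T c := by
  have hq0 : ∀ u, 0 ≤ c s(u, t u) := fun u => hc _ (ht u)
  set F : SimpleGraph (Fin n) :=
    SimpleGraph.fromEdgeSet {e | ∃ u, u ≠ v ∧ ¬ T.Adj u v ∧ e = s(u, v)} with hFdef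
  have hFe : ∀ e ∈ F.edgeSet, ∃ u, u ≠ v ∧ ¬ T.Adj u v ∧ e = s(u, v) := by
    intro e he
    rw [hFdef, SimpleGraph.edgeSet_fromEdgeSet] at he
    exact he.1
  set p : Sym2 (Fin n) → ℝ := fun e => ∑ u with e = s(u, v), c s(u, t u) with hpdef
  have hpv : ∀ u, p s(u, v) = c s(u, t u) := by
    intro u
    have : (Finset.univ.filter (fun x => s(u, v) = s(x, v))) = {u} := by
      ext x
      simp only [SM_mem_fs, Set.mem_sdiff, Finset.mem_filter, Finset.mem_univ, true_and, Finset.mem_singleton,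
        Sym2.congr_left]
      exact eq_comm
    simp only [hpdef, this, Finset.sum_singleton]
  set g : Fin n → Sym2 (Fin n) := fun u => if T.Adj u v then s(u, t u) else s(u, v) with hgdef
  have hwg : ∀ u, u ≠ v → SM_w T c p (g u) = c s(u, t u) := by
    intro u hu
    by_cases h : T.Adj u v
    · simp only [hgdef, h, if_true, SM_w, SimpleGraph.mem_edgeSet, ht u]
    · simp only [hgdef, h, if_false, SM_w, SimpleGraph.mem_edgeSet, hpv]
  have key := SM_core T hT c hc F p
    (by
      intro x y hxy
      obtain ⟨u, h1, h2, h3⟩ := hFe s(x, y) hxy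
      rw [SimpleGraph.compl_adj]
      refine ⟨hxy.ne, fun h => h2 ?_⟩
      have : s(x, y) ∈ T.edgeSet := h
      rw [h3] at this
      exact this)
    (by
      intro e he
      obtain ⟨u, h1, h2, rfl⟩ := hFe e he
      rw [hpv]
      exact hq0 u)
    (Finset.univ.erase v)
    (by
      rw [Finset.card_erase_of_mem (Finset.mem_univ v)]
      simp
      have := v.pos
      omega)
    g
    (by
      intro u hu
      have hu' : u ≠ v := by simpa using hu
      rw [SimpleGraph.edgeSet_sup]
      by_cases h : T.Adj u v
      · left
        simp only [hgdef, h, if_true]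
        exact ht u
      · right
        simp only [hgdef, h, if_false]
        rw [hFdef, SimpleGraph.edgeSet_fromEdgeSet]
        refine ⟨⟨u, hu', h, rfl⟩, ?_⟩
        simpa using hu')
    (by
      set M := SimpleGraph.fromEdgeSet (g '' ((Finset.univ.erase v : Finset (Fin n)) : Set (Fin n)))
        with hM
      have h1 : ∀ u, u ≠ v → ¬ T.Adj u v → M.Reachable u v := by
        intro u hu h
        apply SimpleGraph.Adj.reachable
        rw [hM, SimpleGraph.fromEdgeSet_adj]
        refine ⟨⟨u, by simpa using hu, by simp only [hgdef, h, if_false]⟩, hu⟩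
      have h2 : ∀ u, M.Reachable u v := by
        intro u
        by_cases hu : u = v
        · rw [hu]
        by_cases h : T.Adj u v
        · have h3 : M.Reachable u (t u) := by
            apply SimpleGraph.Adj.reachable
            rw [hM, SimpleGraph.fromEdgeSet_adj]
            refine ⟨⟨u, by simpa using hu, by simp only [hgdef, h, if_true]⟩, (ht u).ne⟩
          by_cases h4 : t u = v
          · rwa [h4] at h3
          · exact h3.trans (h1 _ h4 (htri _ _ _ (ht u).symm h))
        · exact h1 u hu h
      have : Nonempty (Fin n) := ⟨v⟩
      exact ⟨fun x y => (h2 x).trans (h2 y).symm⟩)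
    (by
      intro M' hM' hcon
      obtain ⟨f, hf1, hf2⟩ := SM_parent M' hcon v
      have hedge : ∀ u, u ≠ v → ∀ x, (T ⊔ F).Adj u x → c s(u, t u) ≤ SM_w T c p s(u, x) := by
        intro u hu x hx
        by_cases h : T.Adj u x
        · simp only [SM_w, SimpleGraph.mem_edgeSet, h, if_true]
          exact htmin u x h
        · have hFx : F.Adj u x := by
            rw [SimpleGraph.sup_adj] at hx
            exact hx.resolve_left h
          obtain ⟨y, h1, h2, h3⟩ := hFe s(u, x) hFx
          simp only [SM_w, SimpleGraph.mem_edgeSet, h, if_false]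
          rw [Sym2.eq_iff] at h3
          rcases h3 with h3 | h3
          · rw [h3.2, hpv]
          · exact absurd h3.1 hu
      have hnn : ∀ e ∈ M'.edgeSet, 0 ≤ SM_w T c p e := by
        intro e he
        unfold SM_w
        split_ifs with h
        · exact hc e h
        · simp only [hpdef]
          exact Finset.sum_nonneg (fun u _ => hq0 u)
      calc ∑ u ∈ Finset.univ.erase v, SM_w T c p (g u)
          ≤ ∑ u ∈ Finset.univ.erase v, SM_w T c p s(u, f u) := by
            apply Finset.sum_le_sum
            intro u hu
            have hu' : u ≠ v := by simpa using hu
            rw [hwg u hu']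
            exact hedge u hu' _ (hM' (hf1 u hu'))
        _ = ∑ e ∈ (Finset.univ.erase v).image (fun u => s(u, f u)), SM_w T c p e := by
            rw [Finset.sum_image]
            intro x hx y hy hxy
            exact hf2 (by simpa using hx) (by simpa using hy) hxy
        _ ≤ _ := by
            apply Finset.sum_le_sum_of_subset_of_nonneg
            · intro e he
              simp only [Finset.mem_image] at he
              obtain ⟨u, hu, rfl⟩ := he
              simp only [SM_mem_fs, Finset.mem_filter, Finset.mem_univ, true_and]
              exact hf1 u (by simpa using hu)
            · intro e he _
              simp only [SM_mem_fs, Finset.mem_filter, Finset.mem_univ, true_and] at he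
              exact hnn e he)
  refine le_trans (le_of_eq ?_) key
  apply Finset.sum_congr
  · ext u
    simp only [SM_mem_fs, Set.mem_sdiff, Finset.mem_filter, Finset.mem_univ, true_and, Finset.mem_erase, and_true]
    constructor
    · rintro ⟨h1, h2⟩
      refine ⟨h1, ?_⟩
      simp only [hgdef, h2, if_false]
      exact h2
    · rintro ⟨h1, h2⟩
      refine ⟨h1, fun h => h2 ?_⟩
      simp only [hgdef, h, if_true]
      exact ht u
  · intro u hu
    simp only [Finset.mem_filter, Finset.mem_erase] at hu
    rw [hwg u hu.1.1]

/-- Edge `i` of the path. -/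
def SM_E {m : ℕ} (i : Fin m) : Sym2 (Fin (m + 1)) := s(i.castSucc, i.succ)

theorem SM_E_mem {m : ℕ} (i : Fin m) : SM_E i ∈ (SimpleGraph.pathGraph (m + 1)).edgeSet := by
  unfold SM_E
  rw [SimpleGraph.mem_edgeSet, SimpleGraph.pathGraph_adj]
  simp

theorem SM_E_inj {m : ℕ} : Function.Injective (SM_E (m := m)) := by
  intro i j h
  unfold SM_E at h
  rw [Sym2.eq_iff] at h
  simp only [Fin.ext_iff, Fin.val_castSucc, Fin.val_succ] at h ⊢
  omega

theorem SM_E_surj {m : ℕ} (e : Sym2 (Fin (m + 1)))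
    (he : e ∈ (SimpleGraph.pathGraph (m + 1)).edgeSet) : ∃ i, SM_E i = e := by
  induction e using Sym2.ind with
  | _ x y =>
    rw [SimpleGraph.mem_edgeSet, SimpleGraph.pathGraph_adj] at he
    rcases he with he | he
    · refine ⟨⟨x.val, by omega⟩, ?_⟩
      unfold SM_E
      rw [Sym2.eq_iff]
      left
      simp [Fin.ext_iff, he]
    · refine ⟨⟨y.val, by omega⟩, ?_⟩
      unfold SM_E
      rw [Sym2.eq_iff]
      right
      simp [Fin.ext_iff, he]

open Classical in
theorem SM_path_sum {m : ℕ} (w : Sym2 (Fin (m + 1)) → ℝ) :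
    ∑ e ∈ SM_fs (SimpleGraph.pathGraph (m + 1)).edgeSet, w e = ∑ i : Fin m, w (SM_E i) := by
  rw [← Finset.sum_image (f := w) (s := Finset.univ) (g := SM_E (m := m))
    (fun x _ y _ h => SM_E_inj h)]
  apply Finset.sum_congr _ (fun _ _ => rfl)
  ext e
  simp only [SM_mem_fs, Set.mem_sdiff, Finset.mem_filter, Finset.mem_univ, true_and, Finset.mem_image]
  constructor
  · exact SM_E_surj e
  · rintro ⟨i, rfl⟩
    exact SM_E_mem i

theorem SM_path_tree (m : ℕ) : (SimpleGraph.pathGraph (m + 1)).IsTree := by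
  classical
  rw [SimpleGraph.isTree_iff_connected_and_card]
  refine ⟨SimpleGraph.pathGraph_connected m, ?_⟩
  refine le_antisymm ?_ (SimpleGraph.pathGraph_connected m).card_vert_le_card_edgeSet_add_one
  have h2 : (SimpleGraph.pathGraph (m + 1)).edgeSet ⊆
      (Finset.univ.image (SM_E (m := m)) : Finset _) := by
    intro e he
    obtain ⟨i, h⟩ := SM_E_surj e he
    simp only [Finset.coe_image]
    exact ⟨i, by simp, h⟩
  have h3 := Set.ncard_le_ncard h2 (Set.toFinite _)
  rw [Set.ncard_coe_finset] at h3
  have h4 := h3.trans Finset.card_image_le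
  simp only [Finset.card_univ, Fintype.card_fin] at h4
  have h5 : Nat.card (SimpleGraph.pathGraph (m + 1)).edgeSet ≤ m := h4
  simp only [Nat.card_eq_fintype_card, Fintype.card_fin] at h5 ⊢
  omega

/-- The graph of distance-two pairs. -/
def SM_F2 (n : ℕ) : SimpleGraph (Fin n) where
  Adj x y := x.val + 2 = y.val ∨ y.val + 2 = x.val
  symm := ⟨fun _ _ h => h.symm⟩
  loopless := ⟨fun x h => by omega⟩

/-- A connected spanning subgraph of the path contains all edges. -/
theorem SM_sub_path {m : ℕ} (M : SimpleGraph (Fin (m + 1)))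
    (hM : M ≤ SimpleGraph.pathGraph (m + 1)) (hcon : M.Connected) :
    M = SimpleGraph.pathGraph (m + 1) := by
  apply le_antisymm hM
  have key : ∀ x y : Fin (m + 1), x.val + 1 = y.val → M.Adj x y := by
    intro x y hxy
    by_contra hn
    have hstep : ∀ a b, M.Reachable a b → a.val ≤ x.val → b.val ≤ x.val := by
      rintro a b ⟨q⟩
      induction q with
      | nil => exact id
      | @cons u v w h q ih =>
        intro hu
        apply ih
        have h1 := hM h
        rw [SimpleGraph.pathGraph_adj] at h1
        by_contra hv
        apply hn
        have e1 : u = x := Fin.ext (by omega)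
        have e2 : v = y := Fin.ext (by omega)
        rwa [e1, e2] at h
    have := hstep x y (hcon.preconnected x y) le_rfl
    omega
  intro x y hxy
  rw [SimpleGraph.pathGraph_adj] at hxy
  rcases hxy with h | h
  · exact key x y h
  · exact (key y x h).symm

theorem SM_del_reach {n : ℕ} (M H : SimpleGraph (Fin n)) (a b : Fin n) (hcon : M.Connected)
    (hH : ∀ x y, M.Adj x y → s(x, y) ≠ s(a, b) → H.Adj x y) (x : Fin n) :
    H.Reachable x a ∨ H.Reachable x b := by
  obtain ⟨q⟩ := hcon.preconnected x a
  have : ∀ x y : Fin n, M.Walk x y → y = a → (H.Reachable x a ∨ H.Reachable x b) := by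
    intro x y q
    induction q with
    | nil => rintro rfl; exact Or.inl (SimpleGraph.Reachable.refl _)
    | @cons u v w h q ih =>
      intro hw
      by_cases he : s(u, v) = s(a, b)
      · rw [Sym2.eq_iff] at he
        rcases he with he | he
        · rw [he.1]; exact Or.inl (SimpleGraph.Reachable.refl _)
        · rw [he.1]; exact Or.inr (SimpleGraph.Reachable.refl _)
      · have h1 := (hH u v h he).reachable
        exact (ih hw).imp h1.trans h1.trans
  exact this x a q rfl

open Classical in
/-- Exchange step for the lower bound. -/
theorem SM_lb {m : ℕ} (w : Sym2 (Fin (m + 1)) → ℝ)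
    (hw : ∀ e ∈ (SimpleGraph.pathGraph (m + 1) ⊔ SM_F2 (m + 1)).edgeSet, 0 ≤ w e)
    (hw2 : ∀ x y z : Fin (m + 1), x.val + 1 = y.val → y.val + 1 = z.val →
      w s(x, y) ≤ w s(x, z) ∧ w s(y, z) ≤ w s(x, z)) :
    ∀ (k : ℕ) (M : SimpleGraph (Fin (m + 1))),
      M ≤ SimpleGraph.pathGraph (m + 1) ⊔ SM_F2 (m + 1) → M.Connected →
      (SM_fs (M.edgeSet \ (SimpleGraph.pathGraph (m + 1)).edgeSet)).card = k →
      ∑ i : Fin m, w (SM_E i) ≤ ∑ e ∈ SM_fs M.edgeSet, w e := by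
  intro k
  induction k with
  | zero =>
    intro M hM hcon hk
    have : M = SimpleGraph.pathGraph (m + 1) := by
      apply SM_sub_path M _ hcon
      intro x y hxy
      by_contra hn
      rw [Finset.card_eq_zero] at hk
      have : s(x, y) ∈ SM_fs (M.edgeSet \ (SimpleGraph.pathGraph (m + 1)).edgeSet) :=
        (SM_mem_fs _ _).2 ⟨hxy, hn⟩
      rw [hk] at this
      simp at this
    rw [this, SM_path_sum]
  | succ k ih =>
    intro M hM hcon hk
    have hpos : 0 < (SM_fs (M.edgeSet \ (SimpleGraph.pathGraph (m + 1)).edgeSet)).card := by omega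
    obtain ⟨f, hf⟩ := Finset.card_pos.mp hpos
    have hf0 := hf
    simp only [SM_mem_fs, Finset.mem_filter, Finset.mem_univ, true_and] at hf
    obtain ⟨hfM, hfT⟩ := hf
    obtain ⟨x, z, hxz, rfl⟩ : ∃ x z : Fin (m + 1), x.val + 2 = z.val ∧ f = s(x, z) := by
      have h1 := SimpleGraph.edgeSet_mono hM hfM
      rw [SimpleGraph.edgeSet_sup] at h1
      have h2 := h1.resolve_left hfT
      clear h1 hf0 hfM hfT
      induction f using Sym2.ind with
      | _ x y =>
        rcases h2 with h | h
        · exact ⟨x, y, h, rfl⟩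
        · exact ⟨y, x, h, Sym2.eq_swap⟩
    obtain ⟨y, hy⟩ : ∃ y : Fin (m + 1), y.val = x.val + 1 := ⟨⟨x.val + 1, by omega⟩, rfl⟩
    have hwxyz := hw2 x y z (by omega) (by omega)
    -- the general exchange
    have hex : ∀ e₀ : Sym2 (Fin (m + 1)), e₀ ∈ (SimpleGraph.pathGraph (m + 1)).edgeSet →
        w e₀ ≤ w s(x, z) →
        (SimpleGraph.fromEdgeSet ((M.edgeSet \ {s(x, z)}) ∪ {e₀})).Connected →
        ∑ i : Fin m, w (SM_E i) ≤ ∑ e ∈ SM_fs M.edgeSet, w e := by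
      intro e₀ he₀ hwe hcon'
      set M' := SimpleGraph.fromEdgeSet ((M.edgeSet \ {s(x, z)}) ∪ {e₀}) with hM'
      have hM'e : ∀ e, e ∈ M'.edgeSet → (e ∈ M.edgeSet ∧ e ≠ s(x, z)) ∨ e = e₀ := by
        intro e he
        rw [hM', SimpleGraph.edgeSet_fromEdgeSet] at he
        exact he.1
      have hM'e2 : ∀ e, e ∈ M.edgeSet → e ≠ s(x, z) → e ∈ M'.edgeSet := by
        intro e he hne
        rw [hM', SimpleGraph.edgeSet_fromEdgeSet]
        exact ⟨Or.inl ⟨he, hne⟩, SimpleGraph.not_isDiag_of_mem_edgeSet _ he⟩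
      have h1 := ih M' (by
          rw [← SimpleGraph.edgeSet_subset_edgeSet]
          intro e he
          rcases hM'e e he with h | h
          · exact SimpleGraph.edgeSet_mono hM h.1
          · rw [h, SimpleGraph.edgeSet_sup]; exact Or.inl he₀) hcon' (by
          have : (SM_fs (M'.edgeSet \ (SimpleGraph.pathGraph (m + 1)).edgeSet)) =
              (SM_fs (M.edgeSet \ (SimpleGraph.pathGraph (m + 1)).edgeSet)).erase s(x, z) := by
            ext e
            simp only [SM_mem_fs, Set.mem_sdiff, Finset.mem_filter, Finset.mem_univ, true_and, Finset.mem_erase]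
            constructor
            · rintro ⟨h1, h2⟩
              rcases hM'e e h1 with h | h
              · exact ⟨h.2, h.1, h2⟩
              · exact absurd (h ▸ he₀) h2
            · rintro ⟨h1, h2, h3⟩
              exact ⟨hM'e2 e h2 h1, h3⟩
          rw [this, Finset.card_erase_of_mem hf0, hk]
          rfl)
      refine h1.trans ?_
      have hnn : 0 ≤ w e₀ := hw _ (by rw [SimpleGraph.edgeSet_sup]; exact Or.inl he₀)
      calc ∑ e ∈ SM_fs M'.edgeSet, w e
          ≤ ∑ e ∈ insert e₀ ((SM_fs M.edgeSet).erase s(x, z)), w e := by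
            apply Finset.sum_le_sum_of_subset_of_nonneg
            · intro e he
              simp only [SM_mem_fs, Finset.mem_filter, Finset.mem_univ, true_and] at he
              simp only [SM_mem_fs, Finset.mem_insert, Finset.mem_erase, Finset.mem_filter, Finset.mem_univ,
                true_and]
              rcases hM'e e he with h | h
              · exact Or.inr ⟨h.2, h.1⟩
              · exact Or.inl h
            · intro e he _
              simp only [SM_mem_fs, Finset.mem_insert, Finset.mem_erase, Finset.mem_filter, Finset.mem_univ,
                true_and] at he
              rcases he with rfl | he
              · exact hnn
              · exact hw _ (SimpleGraph.edgeSet_mono hM he.2)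
        _ ≤ w e₀ + ∑ e ∈ (SM_fs M.edgeSet).erase s(x, z), w e := by
            by_cases h : e₀ ∈ (SM_fs M.edgeSet).erase s(x, z)
            · rw [Finset.insert_eq_of_mem h]
              linarith
            · rw [Finset.sum_insert h]
        _ ≤ w s(x, z) + ∑ e ∈ (SM_fs M.edgeSet).erase s(x, z), w e := by
            linarith
        _ = _ := by
            apply Finset.add_sum_erase (SM_fs M.edgeSet) w
            simpa [SM_mem_fs] using hfM
    have hxy : x ≠ y := fun h => by rw [h] at hy; omega
    have hyz : y ≠ z := fun h => by rw [h] at hy; omega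
    have hadj : ∀ e₀ : Sym2 (Fin (m + 1)), ∀ u v, M.Adj u v → s(u, v) ≠ s(x, z) →
        (SimpleGraph.fromEdgeSet ((M.edgeSet \ {s(x, z)}) ∪ {e₀})).Adj u v := by
      intro e₀ u v huv hne
      rw [SimpleGraph.fromEdgeSet_adj]
      exact ⟨Or.inl ⟨huv, hne⟩, huv.ne⟩
    have hfin : ∀ H : SimpleGraph (Fin (m + 1)),
        (∀ u v, M.Adj u v → s(u, v) ≠ s(x, z) → H.Adj u v) → H.Reachable x z → H.Connected := by
      intro H h1 h2
      have h3 : ∀ u, H.Reachable u z := by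
        intro u
        rcases SM_del_reach M H x z hcon h1 u with h | h
        · exact h.trans h2
        · exact h
      exact ⟨fun u v => (h3 u).trans (h3 v).symm⟩
    -- reachability in M minus the edge
    have h0 := SM_del_reach M (SimpleGraph.fromEdgeSet (M.edgeSet \ {s(x, z)})) x z hcon
      (by
        intro u v huv hne
        rw [SimpleGraph.fromEdgeSet_adj]
        exact ⟨⟨huv, hne⟩, huv.ne⟩) y
    have hmono : ∀ e₀ : Sym2 (Fin (m + 1)), SimpleGraph.fromEdgeSet (M.edgeSet \ {s(x, z)}) ≤
        SimpleGraph.fromEdgeSet ((M.edgeSet \ {s(x, z)}) ∪ {e₀}) := fun e₀ =>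
      SimpleGraph.fromEdgeSet_mono Set.subset_union_left
    rcases h0 with h0 | h0
    · apply hex s(y, z) _ hwxyz.2
      · apply hfin _ (hadj _)
        refine (h0.mono (hmono _)).symm.trans ?_
        apply SimpleGraph.Adj.reachable
        rw [SimpleGraph.fromEdgeSet_adj]
        exact ⟨Or.inr rfl, hyz⟩
      · rw [SimpleGraph.mem_edgeSet, SimpleGraph.pathGraph_adj]
        omega
    · apply hex s(x, y) _ hwxyz.1
      · apply hfin _ (hadj _)
        refine SimpleGraph.Reachable.trans ?_ (h0.mono (hmono _))
        apply SimpleGraph.Adj.reachable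
        rw [SimpleGraph.fromEdgeSet_adj]
        exact ⟨Or.inr rfl, hxy⟩
      · rw [SimpleGraph.mem_edgeSet, SimpleGraph.pathGraph_adj]
        omega

/-- Edge `i` is a (tie-broken) local minimum. -/
def SM_loc {m : ℕ} (a : Fin m → ℝ) (i : Fin m) : Prop :=
  (∀ j : Fin m, j.val = i.val + 1 → a i ≤ a j) ∧ (∀ j : Fin m, j.val + 1 = i.val → a i < a j)

open Classical in
/-- Strategy that sells a blue edge for every red edge that is not a local minimum. -/
theorem SM_strat1 {m : ℕ} (c : Sym2 (Fin (m + 1)) → ℝ)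
    (hc : ∀ e ∈ (SimpleGraph.pathGraph (m + 1)).edgeSet, 0 ≤ c e) :
    ∑ i : Fin m with ¬ SM_loc (fun i => c (SM_E i)) i, c (SM_E i) ≤
      optRevenue (SimpleGraph.pathGraph (m + 1)) c := by
  set T := SimpleGraph.pathGraph (m + 1) with hTdef
  set a : Fin m → ℝ := fun i => c (SM_E i) with hadef
  have ha0 : ∀ i, 0 ≤ a i := fun i => hc _ (SM_E_mem i)
  set A : ℕ → ℝ := fun k => if h : k < m then a ⟨k, h⟩ else 0 with hAdef
  have hA : ∀ i : Fin m, A i.val = a i := fun i => by simp [hAdef]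
  have hA0 : ∀ k, 0 ≤ A k := by
    intro k
    simp only [hAdef]
    split_ifs
    · exact ha0 _
    · exact le_rfl
  set p : Sym2 (Fin (m + 1)) → ℝ := Sym2.lift ⟨fun x y =>
    max (A (min x.val y.val)) (A (min x.val y.val + 1)), by
      intro x y; simp only [min_comm]⟩ with hpdef
  have hpxy : ∀ x y : Fin (m + 1), p s(x, y) =
    max (A (min x.val y.val)) (A (min x.val y.val + 1)) := fun x y => rfl
  have hwT : ∀ i : Fin m, SM_w T c p (SM_E i) = a i := by
    intro i
    simp [SM_w, hTdef, SM_E_mem i, hadef]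
  have hnT : ∀ x z : Fin (m + 1), x.val + 2 = z.val → s(x, z) ∉ T.edgeSet := by
    intro x z h
    rw [hTdef, SimpleGraph.mem_edgeSet, SimpleGraph.pathGraph_adj]
    omega
  have hwF : ∀ i j : Fin m, i.val + 1 = j.val →
      SM_w T c p s(i.castSucc, j.succ) = max (a i) (a j) := by
    intro i j h
    have h1 := hnT i.castSucc j.succ (by simp; omega)
    simp only [SM_w, h1, if_false, hpxy]
    have h2 : min (i.castSucc : Fin (m + 1)).val (j.succ : Fin (m + 1)).val = i.val := by
      simp; omega
    rw [h2, hA, h, hA]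
  have hchoice : ∀ i : Fin m, ∃ e : Sym2 (Fin (m + 1)),
      (∃ j : Fin m, i.val + 1 = j.val ∧ a j < a i ∧ e = s(i.castSucc, j.succ)) ∨
      (∃ j : Fin m, j.val + 1 = i.val ∧ a j ≤ a i ∧ e = s(j.castSucc, i.succ)) ∨
      (e = SM_E i ∧ SM_loc a i) := by
    intro i
    by_cases h1 : ∃ j : Fin m, i.val + 1 = j.val ∧ a j < a i
    · obtain ⟨j, h1, h2⟩ := h1
      exact ⟨_, Or.inl ⟨j, h1, h2, rfl⟩⟩
    by_cases h2 : ∃ j : Fin m, j.val + 1 = i.val ∧ a j ≤ a i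
    · obtain ⟨j, h1, h2⟩ := h2
      exact ⟨_, Or.inr (Or.inl ⟨j, h1, h2, rfl⟩)⟩
    refine ⟨_, Or.inr (Or.inr ⟨rfl, ?_, ?_⟩)⟩
    · intro j hj
      by_contra h
      exact h1 ⟨j, hj.symm, not_le.mp h⟩
    · intro j hj
      by_contra h
      exact h2 ⟨j, hj, not_lt.mp h⟩
  choose g hg using hchoice
  have hwg : ∀ i, SM_w T c p (g i) = a i := by
    intro i
    rcases hg i with ⟨j, h1, h2, h3⟩ | ⟨j, h1, h2, h3⟩ | ⟨h1, h2⟩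
    · rw [h3, hwF i j h1, max_eq_left h2.le]
    · rw [h3, hwF j i h1, max_eq_right h2]
    · rw [h1, hwT]
  have hgd : ∀ i, ¬ (g i).IsDiag := by
    intro i
    rcases hg i with ⟨j, h1, h2, h3⟩ | ⟨j, h1, h2, h3⟩ | ⟨h1, h2⟩
    · rw [h3]; simp [Fin.ext_iff]; omega
    · rw [h3]; simp [Fin.ext_iff]; omega
    · rw [h1]; simp [SM_E, Fin.ext_iff]
  have key := SM_core T (SM_path_tree m) c hc (SM_F2 (m + 1)) p
    (by
      intro x y hxy
      rw [SimpleGraph.compl_adj, hTdef, SimpleGraph.pathGraph_adj]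
      refine ⟨hxy.ne, ?_⟩
      rcases hxy with h | h <;> omega)
    (by
      intro e he
      induction e using Sym2.ind with
      | _ x y =>
        rw [hpxy]
        exact le_max_of_le_left (hA0 _))
    (Finset.univ : Finset (Fin m)) (by simp) g
    (by
      intro i _
      rw [SimpleGraph.edgeSet_sup]
      rcases hg i with ⟨j, h1, h2, h3⟩ | ⟨j, h1, h2, h3⟩ | ⟨h1, h2⟩
      · right
        rw [h3]
        left
        simp; omega
      · right
        rw [h3]
        left
        simp; omega
      · left
        rw [h1]; exact SM_E_mem i)
    (by
      set M := SimpleGraph.fromEdgeSet (g '' ((Finset.univ : Finset (Fin m)) : Set (Fin m)))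
        with hM
      have hadj : ∀ i x y, g i = s(x, y) → M.Reachable x y := by
        intro i x y h
        apply SimpleGraph.Adj.reachable
        rw [hM, SimpleGraph.fromEdgeSet_adj]
        refine ⟨⟨i, by simp, h⟩, ?_⟩
        have := hgd i
        rw [h] at this
        simpa using this
      have hreach : ∀ i : Fin m, M.Reachable i.castSucc i.succ := by
        by_contra hcon
        push Not at hcon
        obtain ⟨i0, hi0⟩ := hcon
        obtain ⟨i, hi, hmin⟩ := Finset.exists_min_image
          (Finset.univ.filter (fun i : Fin m => ¬ M.Reachable i.castSucc i.succ))
          (fun i => toLex (a i, i.val)) ⟨i0, by simpa using hi0⟩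
        simp only [Finset.mem_filter, Finset.mem_univ, true_and] at hi hmin
        have hlt : ∀ j : Fin m, (a j < a i ∨ (a j = a i ∧ j.val < i.val)) →
            M.Reachable j.castSucc j.succ := by
          intro j hj
          by_contra h
          have := hmin j h
          rw [Prod.Lex.toLex_le_toLex] at this
          rcases hj with hj | hj <;> rcases this with h' | h'
          · exact lt_asymm hj h'
          · exact absurd h'.1 hj.ne'
          · exact absurd hj.1 h'.ne'
          · have := h'.2
            simp only at this
            omega
        rcases hg i with ⟨j, h1, h2, h3⟩ | ⟨j, h1, h2, h3⟩ | ⟨h1, h2⟩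
        · have h4 := hlt j (Or.inl h2)
          have h5 : j.castSucc = i.succ := by simp [Fin.ext_iff]; omega
          rw [h5] at h4
          exact hi ((hadj i _ _ h3).trans h4.symm)
        · have h4 := hlt j (by
            rcases h2.lt_or_eq with h | h
            · exact Or.inl h
            · exact Or.inr ⟨h, by omega⟩)
          have h5 : j.succ = i.castSucc := by simp [Fin.ext_iff]; omega
          rw [h5] at h4
          exact hi (h4.symm.trans (hadj i _ _ h3))
        · exact hi (hadj i _ _ h1)
      have h0 : ∀ x : Fin (m + 1), M.Reachable 0 x := by
        intro x
        induction x using Fin.induction with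
        | zero => exact SimpleGraph.Reachable.refl _
        | succ i ih => exact ih.trans (hreach i)
      exact ⟨fun x y => (h0 x).symm.trans (h0 y)⟩)
    (by
      intro M' hM' hcon
      have hlb := SM_lb (SM_w T c p)
        (by
          intro e he
          unfold SM_w
          split_ifs with h
          · exact hc e h
          · induction e using Sym2.ind with
            | _ x y =>
              rw [hpxy]
              exact le_max_of_le_left (hA0 _))
        (by
          intro x y z hxy hyz
          obtain ⟨i, hi⟩ : ∃ i : Fin m, i.val = x.val := ⟨⟨x.val, by omega⟩, rfl⟩
          obtain ⟨j, hj⟩ : ∃ j : Fin m, j.val = y.val := ⟨⟨y.val, by omega⟩, rfl⟩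
          have e1 : x = i.castSucc := by simp [Fin.ext_iff, hi]
          have e2 : y = i.succ := by simp [Fin.ext_iff]; omega
          have e3 : y = j.castSucc := by simp [Fin.ext_iff, hj]
          have e4 : z = j.succ := by simp [Fin.ext_iff]; omega
          have f1 : s(x, y) = SM_E i := by rw [e1, e2]; rfl
          have f2 : s(y, z) = SM_E j := by rw [e3, e4]; rfl
          have f3 : s(x, z) = s(i.castSucc, j.succ) := by rw [e1, e4]
          rw [f1, f2, f3, hwT, hwT, hwF i j (by omega)]
          exact ⟨le_max_left _ _, le_max_right _ _⟩)
        _ M' hM' hcon rfl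
      refine le_trans (le_of_eq ?_) hlb
      apply Finset.sum_congr rfl
      intro i _
      rw [hwg, hwT])
  refine le_trans ?_ key
  calc ∑ i : Fin m with ¬ SM_loc a i, a i
      ≤ ∑ i : Fin m with g i ∉ T.edgeSet, a i := by
        apply Finset.sum_le_sum_of_subset_of_nonneg
        · intro i hi
          simp only [Finset.mem_filter, Finset.mem_univ, true_and] at hi ⊢
          rcases hg i with ⟨j, h1, h2, h3⟩ | ⟨j, h1, h2, h3⟩ | ⟨h1, h2⟩
          · rw [h3]; apply hnT; simp; omega
          · rw [h3]; apply hnT; simp; omega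
          · exact absurd h2 hi
        · intro i _ _
          exact ha0 i
    _ = _ := Finset.sum_congr rfl (fun i _ => (hwg i).symm)

open Classical in
/-- Averaging the star strategies. -/
theorem SM_strat2 {m : ℕ} (hm : 2 ≤ m) (c : Sym2 (Fin (m + 1)) → ℝ)
    (hc : ∀ e ∈ (SimpleGraph.pathGraph (m + 1)).edgeSet, 0 ≤ c e) :
    ((m : ℝ) - 2) * (2 * ∑ i : Fin m with SM_loc (fun i => c (SM_E i)) i, c (SM_E i)) ≤
      ((m : ℝ) + 1) * optRevenue (SimpleGraph.pathGraph (m + 1)) c := by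
  set T := SimpleGraph.pathGraph (m + 1) with hTdef
  set a : Fin m → ℝ := fun i => c (SM_E i) with hadef
  have hTadj : ∀ x y, T.Adj x y ↔ x.val + 1 = y.val ∨ y.val + 1 = x.val := fun x y => by
    rw [hTdef, SimpleGraph.pathGraph_adj]
  have ht : ∀ u, ∃ y, T.Adj u y ∧ ∀ x, T.Adj u x → c s(u, y) ≤ c s(u, x) := by
    intro u
    have hne : (Finset.univ.filter (fun x => T.Adj u x)).Nonempty := by
      by_cases hu : u.val = 0
      · refine ⟨⟨1, by omega⟩, ?_⟩
        simp only [Finset.mem_filter, Finset.mem_univ, true_and, hTadj]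
        omega
      · refine ⟨⟨u.val - 1, by omega⟩, ?_⟩
        simp only [Finset.mem_filter, Finset.mem_univ, true_and, hTadj]
        omega
    obtain ⟨y, hy, hmin⟩ := Finset.exists_min_image _ (fun x => c s(u, x)) hne
    simp only [Finset.mem_filter, Finset.mem_univ, true_and] at hy hmin
    exact ⟨y, hy, hmin⟩
  choose t ht htmin using ht
  set q : Fin (m + 1) → ℝ := fun u => c s(u, t u) with hqdef
  have hq0 : ∀ u, 0 ≤ q u := fun u => hc _ (ht u)
  have hstar : ∀ v, ∑ u with (u ≠ v ∧ ¬ T.Adj u v), q u ≤ optRevenue T c := fun v =>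
    SM_star T (SM_path_tree m) c hc t ht
      (by intro x y z h1 h2; rw [hTadj] at *; omega) htmin v
  -- average
  have havg : ((m : ℝ) - 2) * ∑ u, q u ≤ ((m : ℝ) + 1) * optRevenue T c := by
    have h1 : ∑ v, ∑ u with (u ≠ v ∧ ¬ T.Adj u v), q u ≤ ((m : ℝ) + 1) * optRevenue T c := by
      refine (Finset.sum_le_sum (fun v _ => hstar v)).trans (le_of_eq ?_)
      simp
    refine le_trans ?_ h1
    simp_rw [Finset.sum_filter]
    rw [Finset.sum_comm, Finset.mul_sum]
    apply Finset.sum_le_sum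
    intro u _
    rw [← Finset.sum_filter, Finset.sum_const, nsmul_eq_mul]
    apply mul_le_mul_of_nonneg_right _ (hq0 u)
    have hcard : m ≤ (Finset.univ.filter (fun v => u ≠ v ∧ ¬ T.Adj u v)).card + 2 := by
      have h2 := Finset.card_filter_add_card_filter_not (s := (Finset.univ : Finset (Fin (m + 1))))
        (fun v => u ≠ v ∧ ¬ T.Adj u v)
      have h3 : (Finset.univ.filter (fun v => ¬ (u ≠ v ∧ ¬ T.Adj u v))).card ≤ 3 := by
        have : ((Finset.univ.filter (fun v => ¬ (u ≠ v ∧ ¬ T.Adj u v))).image Fin.val) ⊆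
            {u.val - 1, u.val, u.val + 1} := by
          intro k hk
          simp only [Finset.mem_image, Finset.mem_filter, Finset.mem_univ, true_and] at hk
          obtain ⟨v, hv, rfl⟩ := hk
          rw [hTadj, Ne, Fin.ext_iff] at hv
          simp only [Finset.mem_insert, Finset.mem_singleton]
          omega
        have h4 := Finset.card_le_card this
        rw [Finset.card_image_of_injective _ Fin.val_injective] at h4
        exact h4.trans Finset.card_le_three
      simp only [Finset.card_univ, Fintype.card_fin] at h2
      omega
    have : (m : ℝ) ≤ ((Finset.univ.filter (fun v => u ≠ v ∧ ¬ T.Adj u v)).card : ℝ) + 2 := by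
      exact_mod_cast hcard
    linarith
  refine le_trans (mul_le_mul_of_nonneg_left ?_ ?_) havg
  · have hL : ∀ i : Fin m, SM_loc a i → a i ≤ q i.castSucc ∧ a i ≤ q i.succ := by
      intro i hi
      constructor
      · have h1 := (hTadj _ _).1 (ht i.castSucc)
        simp only [Fin.val_castSucc] at h1
        rcases h1 with h1 | h1
        · have : t i.castSucc = i.succ := by simp [Fin.ext_iff]; omega
          simp only [hqdef, this]
          exact le_rfl
        · have h2 := hi.2 ⟨(t i.castSucc).val, by omega⟩ (by simpa using h1)
          refine h2.le.trans (le_of_eq ?_)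
          simp only [hqdef, hadef, SM_E]
          congr 1
          rw [Sym2.eq_swap]
          congr 2
          simp [Fin.ext_iff, h1]
      · have h1 := (hTadj _ _).1 (ht i.succ)
        simp only [Fin.val_succ] at h1
        rcases h1 with h1 | h1
        · have h2 := hi.1 ⟨i.val + 1, by omega⟩ rfl
          refine h2.trans (le_of_eq ?_)
          simp only [hqdef, hadef, SM_E]
          congr 2
          simp [Fin.ext_iff, h1]
        · have : t i.succ = i.castSucc := by simp [Fin.ext_iff]; omega
          simp only [hqdef, this, hadef, SM_E]
          rw [Sym2.eq_swap]
    have hdisj : Disjoint ((Finset.univ.filter (fun i => SM_loc a i)).image Fin.castSucc)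
        ((Finset.univ.filter (fun i => SM_loc a i)).image Fin.succ) := by
      rw [Finset.disjoint_left]
      intro x hx hy
      simp only [Finset.mem_image, Finset.mem_filter, Finset.mem_univ, true_and] at hx hy
      obtain ⟨i, hi, rfl⟩ := hx
      obtain ⟨j, hj, hij⟩ := hy
      have hv : j.val + 1 = i.val := by
        simpa [Fin.ext_iff] using hij
      have h1 := hi.2 j hv
      have h2 := hj.1 i hv.symm
      linarith
    calc 2 * ∑ i : Fin m with SM_loc a i, a i
        = ∑ i : Fin m with SM_loc a i, a i + ∑ i : Fin m with SM_loc a i, a i := by ring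
      _ ≤ ∑ i : Fin m with SM_loc a i, q i.castSucc + ∑ i : Fin m with SM_loc a i, q i.succ := by
          apply add_le_add
          · apply Finset.sum_le_sum
            intro i hi
            exact (hL i (by simpa using hi)).1
          · apply Finset.sum_le_sum
            intro i hi
            exact (hL i (by simpa using hi)).2
      _ = ∑ u ∈ ((Finset.univ.filter (fun i => SM_loc a i)).image Fin.castSucc) ∪
            ((Finset.univ.filter (fun i => SM_loc a i)).image Fin.succ), q u := by
          rw [Finset.sum_union hdisj, Finset.sum_image, Finset.sum_image]
          · intro x _ y _ h; exact Fin.succ_injective _ h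
          · intro x _ y _ h; exact Fin.castSucc_injective _ h
      _ ≤ _ := Finset.sum_le_sum_of_subset_of_nonneg (Finset.subset_univ _) (fun u _ _ => hq0 u)
  · have : (2 : ℝ) ≤ m := by exact_mod_cast hm
    linarith

/-- For the StackMST(0,0) game whose red tree is a path on
`n ≥ 6` vertices with nonnegative edge costs, the optimal revenue satisfies
`r*(P, c) ≥ c(P) / (3/2 + 9/(2n − 10))`. -/
theorem stackMST_path_three_halves_approx
    (n : ℕ) (hn : 6 ≤ n) (c : Sym2 (Fin n) → ℝ)
    (hc : ∀ e ∈ (SimpleGraph.pathGraph n).edgeSet, 0 ≤ c e) :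
    redCost (SimpleGraph.pathGraph n) c / (3 / 2 + 9 / (2 * (n : ℝ) - 10)) ≤
      optRevenue (SimpleGraph.pathGraph n) c := by
  classical
  obtain ⟨m, rfl⟩ : ∃ m, n = m + 1 := ⟨n - 1, by omega⟩
  have h1 := SM_strat1 c hc
  have h2 := SM_strat2 (by omega) c hc
  have hC : redCost (SimpleGraph.pathGraph (m + 1)) c = ∑ i : Fin m, c (SM_E i) := by
    unfold redCost
    rw [SM_esum_eq, SM_path_sum]
  have hsplit := Finset.sum_filter_add_sum_filter_not (Finset.univ : Finset (Fin m))
    (fun i => SM_loc (fun i => c (SM_E i)) i) (fun i => c (SM_E i))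
  have hC0 := SM_redCost_nonneg (SimpleGraph.pathGraph (m + 1)) c hc
  rw [← hC] at hsplit
  have hm : (5 : ℝ) ≤ m := by
    have : 5 ≤ m := by omega
    exact_mod_cast this
  set C := redCost (SimpleGraph.pathGraph (m + 1)) c
  set R := optRevenue (SimpleGraph.pathGraph (m + 1)) c
  set l := ∑ i : Fin m with SM_loc (fun i => c (SM_E i)) i, c (SM_E i)
  have h3 : C - l ≤ R := by linarith
  have h4 : 2 * ((m : ℝ) - 2) * (C - l) ≤ 2 * ((m : ℝ) - 2) * R :=
    mul_le_mul_of_nonneg_left h3 (by linarith)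
  have h5 : 2 * ((m : ℝ) - 2) * C ≤ (3 * (m : ℝ) - 3) * R := by nlinarith
  have h6 : 2 * ((m : ℝ) - 4) * C ≤ (3 * (m : ℝ) - 3) * R := by nlinarith
  push_cast
  have h7 : (3 / 2 + 9 / (2 * ((m : ℝ) + 1) - 10)) = (3 * (m : ℝ) - 3) / (2 * ((m : ℝ) - 4)) := by
    have e1 : 2 * ((m : ℝ) + 1) - 10 ≠ 0 := by
      intro h; linarith
    have e2 : (m : ℝ) - 4 ≠ 0 := by
      intro h; linarith
    have e3 : 2 * ((m : ℝ) + 1) - 10 = 2 * ((m : ℝ) - 4) := by ring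
    rw [e3]
    field_simp
    ring
  rw [h7, div_le_iff₀ (div_pos (by linarith) (by linarith)), mul_div_assoc',
    le_div_iff₀ (by linarith)]
  linarith
end

section
/- Let T be a finite tree rooted at a node s. Then there exists a partition of T into ℓ subtrees T_1, …, T_ℓ (i.e., each T_i is a subtree of T, the vertex sets cover V, the edge sets are pairwise disjoint and cover E(T)) such that: T_ℓ has at most 2 edges and, if T_ℓ has at least one edge, at least one of its edges is incident to s; and for every 1 ≤ j ≤ ℓ − 1, the subtree T_j is either a path with 3 or 4 edges, or a star with at least 3 edges. -/
namespace StackMST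

variable {V : Type*} {G : SimpleGraph V}

/-- A subgraph is a path when it is connected, every vertex has at most two
neighbours in it (being a subgraph of a tree, it is automatically acyclic). -/
def Subgraph.IsPath (H : G.Subgraph) : Prop :=
  H.Connected ∧ ∀ v : V, Set.ncard (H.neighborSet v) ≤ 2

/-- A subgraph is a star when it is connected and some vertex of it (its center)
is incident to all of its edges. -/
def Subgraph.IsStar (H : G.Subgraph) : Prop :=
  H.Connected ∧ ∃ z ∈ H.verts, ∀ e ∈ H.edgeSet, z ∈ e

end StackMST

open StackMST

namespace TD
open Classical

variable {V : Type*}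

/-- Reachability along the edges of `F`. -/
def Rch (F : Finset (Sym2 V)) : V → V → Prop :=
  Relation.ReflTransGen (fun y z => s(y, z) ∈ F)

def Conn (F : Finset (Sym2 V)) (r : V) : Prop :=
  ∀ y z, s(y, z) ∈ F → Rch F r y

def Good (P : Finset (Sym2 V)) : Prop :=
  (∃ a b c d, P = {s(a,b), s(b,c), s(c,d)} ∧ P.card = 3) ∨
  (∃ a b c d e, P = {s(a,b), s(b,c), s(c,d), s(d,e)} ∧ P.card = 4) ∨
  (∃ z a b c, P = {s(z,a), s(z,b), s(z,c)} ∧ P.card = 3)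

def Rem (r : V) (R : Finset (Sym2 V)) : Prop :=
  R = ∅ ∨ (∃ a, R = {s(r,a)}) ∨ (∃ a b, R = {s(r,a), s(r,b)}) ∨
  (∃ a b, R = {s(r,a), s(a,b)})

inductive Tiled : Finset (Sym2 V) → Prop
  | empty : Tiled ∅
  | add (P F) : Good P → Disjoint P F → Tiled F → Tiled (P ∪ F)

def Dec (r : V) (F : Finset (Sym2 V)) : Prop :=
  ∃ R G, Rem r R ∧ Tiled G ∧ Disjoint R G ∧ F = R ∪ G

lemma Tiled.union {A B : Finset (Sym2 V)} (hA : Tiled A) (hB : Tiled B)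
    (h : Disjoint A B) : Tiled (A ∪ B) := by
  induction hA with
  | empty => simpa using hB
  | add P F hP hd hF ih =>
    rw [Finset.disjoint_union_left] at h
    rw [Finset.union_assoc]
    exact Tiled.add _ _ hP (by rw [Finset.disjoint_union_right]; exact ⟨hd, h.1⟩) (ih h.2)

lemma Good.tiled {P : Finset (Sym2 V)} (h : Good P) : Tiled P := by
  simpa using Tiled.add P ∅ h (by simp) Tiled.empty

lemma Dec.addTiled {r : V} {F G : Finset (Sym2 V)} (h : Dec r F) (hG : Tiled G)
    (hd : Disjoint F G) : Dec r (F ∪ G) := by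
  obtain ⟨R, K, hR, hK, hRK, rfl⟩ := h
  rw [Finset.disjoint_union_left] at hd
  exact ⟨R, K ∪ G, hR, hK.union hG hd.2, by
    rw [Finset.disjoint_union_right]; exact ⟨hRK, hd.1⟩, Finset.union_assoc _ _ _⟩

lemma Rem.dec {r : V} {R : Finset (Sym2 V)} (h : Rem r R) : Dec r R :=
  ⟨R, ∅, h, Tiled.empty, by simp, by simp⟩

lemma Good.dec {r : V} {R : Finset (Sym2 V)} (h : Good R) : Dec r R :=
  ⟨∅, R, Or.inl rfl, h.tiled, by simp, by simp⟩

lemma step1 {r c : V} {R : Finset (Sym2 V)} (h : Rem c R) (hd : s(r,c) ∉ R) :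
    Good (insert s(r,c) R) ∨ insert s(r,c) R = {s(r,c)} ∨
      ∃ x, insert s(r,c) R = {s(r,c), s(c,x)} := by
  rcases h with rfl | ⟨a, rfl⟩ | ⟨a, b, rfl⟩ | ⟨a, b, rfl⟩
  · simp
  · exact Or.inr (Or.inr ⟨a, rfl⟩)
  · by_cases hab : a = b
    · subst hab
      exact Or.inr (Or.inr ⟨a, by simp⟩)
    · left; right; right
      refine ⟨c, r, a, b, by rw [Sym2.eq_swap], ?_⟩
      rw [Finset.card_insert_of_notMem hd, Finset.card_pair]
      grind
  · by_cases hab : s(c,a) = s(a,b)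
    · refine Or.inr (Or.inr ⟨a, by simp [← hab]⟩)
    · left; left
      refine ⟨r, c, a, b, rfl, ?_⟩
      rw [Finset.card_insert_of_notMem hd, Finset.card_pair hab]

lemma step2a {r c : V} {R : Finset (Sym2 V)} (h : Rem r R) (hd : s(r,c) ∉ R) :
    Dec r (insert s(r,c) R) := by
  rcases h with rfl | ⟨a, rfl⟩ | ⟨a, b, rfl⟩ | ⟨a, b, rfl⟩
  · exact Rem.dec (Or.inr (Or.inl ⟨c, by simp⟩))
  · exact Rem.dec (Or.inr (Or.inr (Or.inl ⟨c, a, rfl⟩)))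
  · by_cases hab : a = b
    · subst hab
      exact Rem.dec (Or.inr (Or.inr (Or.inl ⟨c, a, by simp⟩)))
    · apply Good.dec; right; right
      refine ⟨r, c, a, b, rfl, ?_⟩
      rw [Finset.card_insert_of_notMem hd, Finset.card_pair]
      grind
  · by_cases hab : s(r,a) = s(a,b)
    · exact Rem.dec (Or.inr (Or.inr (Or.inl ⟨c, a, by simp [← hab]⟩)))
    · apply Good.dec; left
      refine ⟨c, r, a, b, by rw [Sym2.eq_swap], ?_⟩
      rw [Finset.card_insert_of_notMem hd, Finset.card_pair hab]

lemma step2b {r c x : V} {R : Finset (Sym2 V)} (h : Rem r R) (hd : s(r,c) ∉ R)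
    (hd' : s(c,x) ∉ R) (hne : s(r,c) ≠ s(c,x)) :
    Dec r ({s(r,c), s(c,x)} ∪ R) := by
  have key : ∀ a, s(r,c) ≠ s(r,a) → s(c,x) ≠ s(r,a) → Good {s(r,c), s(c,x), s(r,a)} := by
    intro a h1 h2
    left
    refine ⟨x, c, r, a, ?_, ?_⟩
    · rw [Sym2.eq_swap (a := x), Sym2.eq_swap (a := c) (b := r)]
      ext; simp; tauto
    · rw [Finset.card_eq_three]
      exact ⟨_, _, _, hne, h1, h2, rfl⟩
  rcases h with rfl | ⟨a, rfl⟩ | ⟨a, b, rfl⟩ | ⟨a, b, rfl⟩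
  · exact Rem.dec (Or.inr (Or.inr (Or.inr ⟨c, x, by simp⟩)))
  · simp only [Finset.mem_singleton] at hd hd'
    have := (key a hd hd').dec (r := r)
    convert this using 1
    ext; simp
  · simp only [Finset.mem_singleton, Finset.mem_insert, not_or] at hd hd'
    by_cases hab : a = b
    · subst hab
      have := (key a hd.1 hd'.1).dec (r := r)
      convert this using 1
      ext; simp
    · have h0 : s(r,a) ≠ s(r,b) := by grind
      have h1 : Dec r {s(r,b)} := Rem.dec (Or.inr (Or.inl ⟨b, rfl⟩))
      have := h1.addTiled (key a hd.1 hd'.1).tiled (by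
        simp only [Finset.disjoint_singleton_left, Finset.mem_insert, Finset.mem_singleton]
        rintro (h | h | h)
        · exact hd.2 h.symm
        · exact hd'.2 h.symm
        · exact h0 h.symm)
      convert this using 1
      ext; simp; tauto
  · simp only [Finset.mem_singleton, Finset.mem_insert, not_or] at hd hd'
    by_cases hab : s(r,a) = s(a,b)
    · have := (key a hd.1 hd'.1).dec (r := r)
      convert this using 1
      rw [← hab]
      ext; simp
    · apply Good.dec; right; left
      refine ⟨x, c, r, a, b, ?_, ?_⟩
      · rw [Sym2.eq_swap (a := x), Sym2.eq_swap (a := c) (b := r)]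
        ext; simp; tauto
      · have : ({s(r,c), s(c,x)} ∪ {s(r,a), s(a,b)} : Finset (Sym2 V))
          = insert s(r,c) (insert s(c,x) {s(r,a), s(a,b)}) := by ext; simp; tauto
        rw [this, Finset.card_insert_of_notMem, Finset.card_insert_of_notMem,
          Finset.card_pair hab]
        · simp only [Finset.mem_singleton, Finset.mem_insert, not_or]; exact hd'
        · simp only [Finset.mem_singleton, Finset.mem_insert, not_or]; exact ⟨hne, hd⟩

lemma combine {r c : V} {A B : Finset (Sym2 V)} (hA : Dec r A) (hB : Dec c B)
    (hAB : Disjoint A B) (h1 : s(r,c) ∉ A) (h2 : s(r,c) ∉ B) :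
    Dec r (insert s(r,c) (A ∪ B)) := by
  obtain ⟨RA, GA, hRA, hGA, hdA, rfl⟩ := hA
  obtain ⟨RB, GB, hRB, hGB, hdB, rfl⟩ := hB
  simp only [Finset.mem_union, not_or] at h1 h2
  simp only [Finset.disjoint_union_left, Finset.disjoint_union_right] at hAB
  obtain ⟨⟨d1, d2⟩, d3, d4⟩ := hAB
  have hG : Tiled (GA ∪ GB) := hGA.union hGB d4
  suffices h : Dec r (insert s(r,c) RB ∪ RA) by
    have := h.addTiled hG (by
      simp only [Finset.disjoint_union_left, Finset.disjoint_union_right,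
        Finset.disjoint_insert_left]
      have := d2.symm
      tauto)
    convert this using 1
    ext; simp; tauto
  have hRB' : Disjoint RA (insert s(r,c) RB) := by
    rw [Finset.disjoint_insert_right]; exact ⟨h1.1, d1⟩
  rcases step1 hRB h2.1 with h | h | ⟨x, h⟩
  · rw [Finset.union_comm]
    exact hRA.dec.addTiled h.tiled hRB'
  · rw [h]
    exact step2a hRA h1.1
  · rw [h]
    rw [h] at hRB'
    simp only [Finset.disjoint_insert_right, Finset.disjoint_singleton_right] at hRB'
    by_cases hne : s(r,c) = s(c,x)
    · rw [← hne]; simpa using step2a hRA h1.1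
    · exact step2b hRA hRB'.1 hRB'.2 hne

lemma Rch.symm' {F : Finset (Sym2 V)} {x y : V} (h : Rch F x y) : Rch F y x := by
  induction h with
  | refl => exact Relation.ReflTransGen.refl
  | tail _ h ih => exact Relation.ReflTransGen.head (by rw [Sym2.eq_swap]; exact h) ih

theorem main (n : ℕ) : ∀ (F : Finset (Sym2 V)) (r : V), F.card ≤ n → Conn F r → Dec r F := by
  induction n with
  | zero =>
    intro F r h _
    have : F = ∅ := by simpa using h
    subst this
    exact Rem.dec (Or.inl rfl)
  | succ n ih =>
    intro F r hn hc
    by_cases hF : F = ∅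
    · subst hF
      exact Rem.dec (Or.inl rfl)
    obtain ⟨c, hcF⟩ : ∃ c, s(r,c) ∈ F := by
      obtain ⟨e, he⟩ := Finset.nonempty_iff_ne_empty.mpr hF
      induction e using Sym2.ind with
      | _ x y =>
      rcases Relation.ReflTransGen.cases_head (hc x y he) with h | ⟨c, h, _⟩
      · subst h; exact ⟨y, he⟩
      · exact ⟨c, h⟩
    set F' := F.erase s(r,c) with hF'
    have hor : ∀ x, Rch F r x → Rch F' r x ∨ Rch F' c x := by
      intro x hx
      induction hx with
      | refl => exact Or.inl Relation.ReflTransGen.refl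
      | @tail y z _ hyz ihy =>
        by_cases h : s(y,z) = s(r,c)
        · rw [Sym2.eq_iff] at h
          rcases h with ⟨rfl, rfl⟩ | ⟨rfl, rfl⟩
          · exact Or.inr Relation.ReflTransGen.refl
          · exact Or.inl Relation.ReflTransGen.refl
        · have : s(y,z) ∈ F' := Finset.mem_erase.mpr ⟨h, hyz⟩
          exact ihy.imp (fun h => h.tail this) (fun h => h.tail this)
    let A := F'.filter (fun e => ∃ x ∈ e, Rch F' r x)
    let B := F'.filter (fun e => ¬ ∃ x ∈ e, Rch F' r x)
    have hAB : A ∪ B = F' := Finset.filter_union_filter_not_eq _ _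
    have hdis : Disjoint A B := Finset.disjoint_filter_filter_not _ _ _
    have hcard : F'.card ≤ n := by
      rw [hF', Finset.card_erase_of_mem hcF]; omega
    have hA : ∀ x, Rch F' r x → Rch A r x := by
      intro x hx
      induction hx with
      | refl => exact Relation.ReflTransGen.refl
      | @tail y z hy hyz ihy =>
        exact ihy.tail (Finset.mem_filter.mpr ⟨hyz, y, by simp, hy⟩)
    have hB : ∀ x, Rch F' c x → ¬ Rch F' r x → Rch B c x := by
      intro x hx
      induction hx with
      | refl => intro _; exact Relation.ReflTransGen.refl
      | @tail y z hy hyz ihy =>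
        intro hz
        have hy' : ¬ Rch F' r y := fun h => hz (h.tail hyz)
        refine (ihy hy').tail (Finset.mem_filter.mpr ⟨hyz, ?_⟩)
        rintro ⟨w, hw, hw'⟩
        rw [Sym2.mem_iff] at hw
        rcases hw with rfl | rfl
        · exact hy' hw'
        · exact hz hw'
    have dA : Dec r A := by
      refine ih A r ((Finset.card_le_card (Finset.filter_subset _ _)).trans hcard) ?_
      intro y z h
      obtain ⟨h, w, hw, hw'⟩ := Finset.mem_filter.mp h
      apply hA
      rw [Sym2.mem_iff] at hw
      rcases hw with rfl | rfl
      · exact hw'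
      · exact hw'.tail (by rw [Sym2.eq_swap]; exact h)
    have dB : Dec c B := by
      refine ih B c ((Finset.card_le_card (Finset.filter_subset _ _)).trans hcard) ?_
      intro y z h
      obtain ⟨h, hw⟩ := Finset.mem_filter.mp h
      have hy : ¬ Rch F' r y := fun h' => hw ⟨y, by simp, h'⟩
      exact hB y ((hor y (hc y z (Finset.mem_of_mem_erase h))).resolve_left hy) hy
    have hnF' : s(r,c) ∉ F' := Finset.notMem_erase _ _
    rw [← hAB, Finset.mem_union, not_or] at hnF'
    have := combine dA dB hdis hnF'.1 hnF'.2
    rwa [hAB, hF', Finset.insert_erase hcF] at this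

/-- The subgraph with edge set `P` and the additional vertex `r`. -/
def sub (T : SimpleGraph V) (P : Finset (Sym2 V)) (r : V) (h : ∀ e ∈ P, e ∈ T.edgeSet) :
    T.Subgraph where
  verts := insert r {v | ∃ w, s(v, w) ∈ P}
  Adj u v := s(u, v) ∈ P
  adj_sub := fun h' => h _ h'
  edge_vert := fun h' => Or.inr ⟨_, h'⟩
  symm := ⟨fun u v h' => by rwa [Sym2.eq_swap]⟩

lemma sub_edgeSet (T : SimpleGraph V) (P : Finset (Sym2 V)) (r : V)
    (h : ∀ e ∈ P, e ∈ T.edgeSet) : (sub T P r h).edgeSet = (P : Set (Sym2 V)) := by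
  ext e
  induction e using Sym2.ind with
  | _ x y => simp [sub]

lemma sub_connected (T : SimpleGraph V) (P : Finset (Sym2 V)) (r : V)
    (h : ∀ e ∈ P, e ∈ T.edgeSet) (hc : Conn P r) : (sub T P r h).Connected := by
  have hr : r ∈ (sub T P r h).verts := Or.inl rfl
  have key : ∀ x, Rch P r x → ∃ hx : x ∈ (sub T P r h).verts,
      (sub T P r h).coe.Reachable ⟨r, hr⟩ ⟨x, hx⟩ := by
    intro x hx
    induction hx with
    | refl => exact ⟨hr, SimpleGraph.Reachable.refl _⟩
    | @tail y z _ hyz ih =>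
      obtain ⟨hy, ih⟩ := ih
      refine ⟨Or.inr ⟨y, by rwa [Sym2.eq_swap]⟩, ih.trans ?_⟩
      apply SimpleGraph.Adj.reachable
      exact hyz
  have key2 : ∀ x : (sub T P r h).verts, (sub T P r h).coe.Reachable ⟨r, hr⟩ x := by
    rintro ⟨x, hx⟩
    rcases hx with rfl | ⟨w, hw⟩
    · exact SimpleGraph.Reachable.refl _
    · exact (key x (hc x w hw)).2
  rw [SimpleGraph.Subgraph.connected_iff', SimpleGraph.connected_iff_exists_forall_reachable]
  exact ⟨⟨r, hr⟩, key2⟩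

def GoodSub {T : SimpleGraph V} (H : T.Subgraph) : Prop :=
  (Subgraph.IsPath H ∧ (Set.ncard (H.edgeSet) = 3 ∨ Set.ncard (H.edgeSet) = 4)) ∨
        (Subgraph.IsStar H ∧ 3 ≤ Set.ncard (H.edgeSet))

lemma rch_cons {P : Finset (Sym2 V)} {a b c : V} (h : s(a,b) ∈ P) (h' : Rch P b c) :
    Rch P a c := Relation.ReflTransGen.head h h'

lemma ncard_pair_le' (x y : V) : ({x, y} : Set V).ncard ≤ 2 :=
  (Set.ncard_insert_le _ _).trans (by simp)

lemma noTri {T : SimpleGraph V} (hT : T.IsAcyclic) {a b c : V}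
    (h1 : T.Adj a b) (h2 : T.Adj b c) (h3 : T.Adj c a) : False := by
  refine hT (.cons h1 (.cons h2 (.cons h3 .nil))) ?_
  have := h1.ne
  have := h2.ne
  have := h3.ne
  rw [SimpleGraph.Walk.cons_isCycle_iff]
  simp
  grind

lemma Good.exists_sub {T : SimpleGraph V} (hT : T.IsAcyclic) {P : Finset (Sym2 V)}
    (h : ∀ e ∈ P, e ∈ T.edgeSet) (hP : Good P) :
    ∃ H : T.Subgraph, H.Connected ∧ GoodSub H ∧ H.edgeSet = (P : Set (Sym2 V)) := by
  rcases hP with ⟨a, b, c, d, hP, hcard⟩ | ⟨a, b, c, d, e, hP, hcard⟩ | ⟨z, a, b, c, hP, hcard⟩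
  · have e1 : s(a,b) ∈ P := by simp [hP]
    have e2 : s(b,c) ∈ P := by simp [hP]
    have e3 : s(c,d) ∈ P := by simp [hP]
    have r0 : Rch P a a := Relation.ReflTransGen.refl
    have r1 : Rch P a b := r0.tail e1
    have r2 : Rch P a c := r1.tail e2
    have r3 : Rch P a d := r2.tail e3
    have hc : (sub T P a h).Connected := by
      apply sub_connected
      intro y z hyz
      simp only [hP, Finset.mem_insert, Finset.mem_singleton, Sym2.eq_iff] at hyz
      rcases hyz with (⟨rfl, _⟩ | ⟨rfl, _⟩) | (⟨rfl, _⟩ | ⟨rfl, _⟩) | (⟨rfl, _⟩ | ⟨rfl, _⟩) <;>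
        assumption
    refine ⟨sub T P a h, hc, Or.inl ⟨⟨hc, ?_⟩, ?_⟩, sub_edgeSet _ _ _ _⟩
    · intro v
      have a1 : T.Adj a b := h _ e1
      have a2 : T.Adj b c := h _ e2
      have a3 : T.Adj c d := h _ e3
      have n1 := a1.ne
      have n2 := a2.ne
      have n3 := a3.ne
      have m1 : a ≠ c := by
        rintro rfl
        have : P ⊆ {s(a,b), s(a,d)} := by
          rw [hP, Sym2.eq_swap (a := b)]; simp
        have := (Finset.card_le_card this).trans Finset.card_le_two
        omega
      have m2 : b ≠ d := by
        rintro rfl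
        have : P ⊆ {s(a,b), s(b,c)} := by
          rw [hP, Sym2.eq_swap (a := c)]; simp
        have := (Finset.card_le_card this).trans Finset.card_le_two
        omega
      have : ∃ x y, (sub T P a h).neighborSet v ⊆ {x, y} := by
        have hn : ∀ w, w ∈ (sub T P a h).neighborSet v → s(v,w) ∈ P := fun w hw => hw
        by_cases v1 : v = b
        · exact ⟨a, c, fun w hw => by
            have := hn w hw
            simp only [hP, Finset.mem_insert, Finset.mem_singleton, Sym2.eq_iff] at this
            grind⟩
        by_cases v2 : v = c
        · exact ⟨b, d, fun w hw => by
            have := hn w hw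
            simp only [hP, Finset.mem_insert, Finset.mem_singleton, Sym2.eq_iff] at this
            grind⟩
        exact ⟨b, c, fun w hw => by
            have := hn w hw
            simp only [hP, Finset.mem_insert, Finset.mem_singleton, Sym2.eq_iff] at this
            grind⟩
      obtain ⟨x, y, hxy⟩ := this
      exact (Set.ncard_le_ncard hxy).trans (ncard_pair_le' x y)
    · left; rw [sub_edgeSet, Set.ncard_coe_finset, hcard]
  · have e1 : s(a,b) ∈ P := by simp [hP]
    have e2 : s(b,c) ∈ P := by simp [hP]
    have e3 : s(c,d) ∈ P := by simp [hP]
    have e4 : s(d,e) ∈ P := by simp [hP]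
    have r0 : Rch P a a := Relation.ReflTransGen.refl
    have r1 : Rch P a b := r0.tail e1
    have r2 : Rch P a c := r1.tail e2
    have r3 : Rch P a d := r2.tail e3
    have r4 : Rch P a e := r3.tail e4
    have hc : (sub T P a h).Connected := by
      apply sub_connected
      intro y z hyz
      simp only [hP, Finset.mem_insert, Finset.mem_singleton, Sym2.eq_iff] at hyz
      rcases hyz with (⟨rfl, _⟩ | ⟨rfl, _⟩) | (⟨rfl, _⟩ | ⟨rfl, _⟩) | (⟨rfl, _⟩ | ⟨rfl, _⟩) |
        (⟨rfl, _⟩ | ⟨rfl, _⟩) <;> assumption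
    refine ⟨sub T P a h, hc, Or.inl ⟨⟨hc, ?_⟩, ?_⟩, sub_edgeSet _ _ _ _⟩
    · intro v
      have a1 : T.Adj a b := h _ e1
      have a2 : T.Adj b c := h _ e2
      have a3 : T.Adj c d := h _ e3
      have a4 : T.Adj d e := h _ e4
      have n1 := a1.ne
      have n2 := a2.ne
      have n3 := a3.ne
      have n4 := a4.ne
      have m1 : a ≠ c := by
        rintro rfl
        have : P ⊆ {s(a,b), s(a,d), s(d,e)} := by
          rw [hP, Sym2.eq_swap (a := b)]; simp
        have := (Finset.card_le_card this).trans Finset.card_le_three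
        omega
      have m2 : b ≠ d := by
        rintro rfl
        have : P ⊆ {s(a,b), s(b,c), s(b,e)} := by
          rw [hP, Sym2.eq_swap (a := c)]; simp
        have := (Finset.card_le_card this).trans Finset.card_le_three
        omega
      have m3 : c ≠ e := by
        rintro rfl
        have : P ⊆ {s(a,b), s(b,c), s(c,d)} := by
          rw [hP, Sym2.eq_swap (a := d)]; simp
        have := (Finset.card_le_card this).trans Finset.card_le_three
        omega
      have m4 : a ≠ d := by
        rintro rfl
        exact noTri hT a1 a2 a3
      have m5 : b ≠ e := by
        rintro rfl
        exact noTri hT a2 a3 a4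
      have : ∃ x y, (sub T P a h).neighborSet v ⊆ {x, y} := by
        have hn : ∀ w, w ∈ (sub T P a h).neighborSet v → s(v,w) ∈ P := fun w hw => hw
        by_cases v1 : v = b
        · exact ⟨a, c, fun w hw => by
            have := hn w hw
            simp only [hP, Finset.mem_insert, Finset.mem_singleton, Sym2.eq_iff] at this
            grind⟩
        by_cases v2 : v = d
        · exact ⟨c, e, fun w hw => by
            have := hn w hw
            simp only [hP, Finset.mem_insert, Finset.mem_singleton, Sym2.eq_iff] at this
            grind⟩
        exact ⟨b, d, fun w hw => by
            have := hn w hw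
            simp only [hP, Finset.mem_insert, Finset.mem_singleton, Sym2.eq_iff] at this
            grind⟩
      obtain ⟨x, y, hxy⟩ := this
      exact (Set.ncard_le_ncard hxy).trans (ncard_pair_le' x y)
    · right; rw [sub_edgeSet, Set.ncard_coe_finset, hcard]
  · have e1 : s(z,a) ∈ P := by simp [hP]
    have e2 : s(z,b) ∈ P := by simp [hP]
    have e3 : s(z,c) ∈ P := by simp [hP]
    have r0 : Rch P z z := Relation.ReflTransGen.refl
    have r1 : Rch P z a := r0.tail e1
    have r2 : Rch P z b := r0.tail e2
    have r3 : Rch P z c := r0.tail e3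
    have hc : (sub T P z h).Connected := by
      apply sub_connected
      intro y w hyz
      simp only [hP, Finset.mem_insert, Finset.mem_singleton, Sym2.eq_iff] at hyz
      rcases hyz with (⟨rfl, _⟩ | ⟨rfl, _⟩) | (⟨rfl, _⟩ | ⟨rfl, _⟩) | (⟨rfl, _⟩ | ⟨rfl, _⟩) <;>
        assumption
    refine ⟨sub T P z h, hc, Or.inr ⟨⟨hc, z, Or.inl rfl, ?_⟩, ?_⟩, sub_edgeSet _ _ _ _⟩
    · rw [sub_edgeSet]
      intro e he
      simp only [hP, Finset.coe_insert, Finset.coe_singleton, Set.mem_insert_iff,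
        Set.mem_singleton_iff] at he
      rcases he with rfl | rfl | rfl <;> simp
    · rw [sub_edgeSet, Set.ncard_coe_finset, hcard]

lemma Tiled.extract {T : SimpleGraph V} (hT : T.IsAcyclic) {F : Finset (Sym2 V)} (hF : Tiled F)
    (h : ∀ e ∈ F, e ∈ T.edgeSet) :
    ∃ (n : ℕ) (H : Fin n → T.Subgraph), (∀ i, (H i).Connected) ∧ (∀ i, GoodSub (H i)) ∧
      (∀ i j, i ≠ j → Disjoint ((H i).edgeSet) ((H j).edgeSet)) ∧
      (∀ e, e ∈ F ↔ ∃ i, e ∈ (H i).edgeSet) := by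
  induction hF with
  | empty => exact ⟨0, Fin.elim0, by simp, by simp, by simp, by simp⟩
  | add P F hP hd _ ih =>
    obtain ⟨n, H, h1, h2, h3, h4⟩ := ih (fun e he => h e (Finset.mem_union_right _ he))
    obtain ⟨K, k1, k2, k3⟩ := hP.exists_sub hT (fun e he => h e (Finset.mem_union_left _ he))
    have hKH : ∀ i, Disjoint K.edgeSet (H i).edgeSet := by
      intro i
      rw [k3, Set.disjoint_left]
      intro e he hi
      exact Finset.disjoint_left.mp hd he ((h4 e).mpr ⟨i, hi⟩)
    refine ⟨n + 1, Fin.cons K H, ?_, ?_, ?_, ?_⟩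
    · intro i; refine Fin.cases ?_ ?_ i <;> simp [*]
    · intro i; refine Fin.cases ?_ ?_ i <;> simp [*]
    · intro i j
      refine Fin.cases ?_ (fun i => ?_) i <;> refine Fin.cases ?_ (fun j => ?_) j
      · simp
      · intro _; simpa using hKH j
      · intro _; simpa using (hKH i).symm
      · intro hij; simpa using h3 i j (by rintro rfl; exact hij rfl)
    · intro e
      rw [Finset.mem_union, h4, Fin.exists_fin_succ]
      simp [k3]

lemma Rem.conn {r : V} {R : Finset (Sym2 V)} (h : Rem r R) : Conn R r := by
  have r0 : Rch R r r := Relation.ReflTransGen.refl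
  intro y z hyz
  rcases h with hR | ⟨a, hR⟩ | ⟨a, b, hR⟩ | ⟨a, b, hR⟩
  · simp [hR] at hyz
  · have r1 : Rch R r a := r0.tail (by simp [hR])
    simp only [hR, Finset.mem_singleton, Sym2.eq_iff] at hyz
    rcases hyz with (⟨rfl, _⟩ | ⟨rfl, _⟩) <;> assumption
  · have r1 : Rch R r a := r0.tail (by simp [hR])
    have r2 : Rch R r b := r0.tail (by simp [hR])
    simp only [hR, Finset.mem_insert, Finset.mem_singleton, Sym2.eq_iff] at hyz
    rcases hyz with (⟨rfl, _⟩ | ⟨rfl, _⟩) | (⟨rfl, _⟩ | ⟨rfl, _⟩) <;> assumption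
  · have r1 : Rch R r a := r0.tail (by simp [hR])
    have r2 : Rch R r b := r1.tail (by simp [hR])
    simp only [hR, Finset.mem_insert, Finset.mem_singleton, Sym2.eq_iff] at hyz
    rcases hyz with (⟨rfl, _⟩ | ⟨rfl, _⟩) | (⟨rfl, _⟩ | ⟨rfl, _⟩) <;> assumption

lemma Rem.card {r : V} {R : Finset (Sym2 V)} (h : Rem r R) : R.card ≤ 2 := by
  rcases h with rfl | ⟨a, rfl⟩ | ⟨a, b, rfl⟩ | ⟨a, b, rfl⟩
  · simp
  · simp
  · exact Finset.card_le_two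
  · exact Finset.card_le_two

lemma Rem.inc {r : V} {R : Finset (Sym2 V)} (h : Rem r R) (hne : R.Nonempty) :
    ∃ e ∈ R, r ∈ e := by
  rcases h with rfl | ⟨a, rfl⟩ | ⟨a, b, rfl⟩ | ⟨a, b, rfl⟩
  · simp at hne
  all_goals exact ⟨s(r,a), by simp, by simp⟩

end TD

/-- Every finite tree `T` rooted at a node `s` admits a partition
into subtrees `T₁, …, T_ℓ` (connected subgraphs, whose vertex sets cover `V` and
whose edge sets are pairwise disjoint and cover `E(T)`) such that the last subtree
has at most 2 edges and, if it has an edge, one of its edges is incident to `s`,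
while every other subtree is either a path with 3 or 4 edges or a star with at
least 3 edges. -/
theorem tree_decomposition {V : Type*} [Finite V]
    (T : SimpleGraph V) (hT : T.IsTree) (s : V) :
    ∃ (ℓ : ℕ) (H : Fin (ℓ + 1) → T.Subgraph),
      (∀ i, (H i).Connected) ∧
      (∀ v : V, ∃ i, v ∈ (H i).verts) ∧
      (∀ e ∈ T.edgeSet, ∃ i, e ∈ (H i).edgeSet) ∧
      (∀ i j, i ≠ j → Disjoint ((H i).edgeSet) ((H j).edgeSet)) ∧
      (Set.ncard ((H (Fin.last ℓ)).edgeSet) ≤ 2) ∧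
      (((H (Fin.last ℓ)).edgeSet).Nonempty →
        ∃ e ∈ (H (Fin.last ℓ)).edgeSet, s ∈ e) ∧
      (∀ i, i ≠ Fin.last ℓ →
        (Subgraph.IsPath (H i) ∧ (Set.ncard ((H i).edgeSet) = 3 ∨
            Set.ncard ((H i).edgeSet) = 4)) ∨
        (Subgraph.IsStar (H i) ∧ 3 ≤ Set.ncard ((H i).edgeSet))) := by
  classical
  have : Fintype V := Fintype.ofFinite V
  let F : Finset (Sym2 V) := T.edgeFinset
  have hF : ∀ e, e ∈ F ↔ e ∈ T.edgeSet := fun e => SimpleGraph.mem_edgeFinset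
  have hconn : TD.Conn F s := by
    intro y z hyz
    clear hyz
    obtain ⟨w⟩ := hT.connected.preconnected y s
    apply TD.Rch.symm'
    induction w with
    | nil => exact Relation.ReflTransGen.refl
    | cons hadj _ ih => exact Relation.ReflTransGen.head ((hF _).mpr hadj) ih
  obtain ⟨R, K, hR, hK, hRK, hFRK⟩ := TD.main _ F s le_rfl hconn
  have hRT : ∀ e ∈ R, e ∈ T.edgeSet := fun e he => (hF e).mp (by rw [hFRK]; simp [he])
  have hKT : ∀ e ∈ K, e ∈ T.edgeSet := fun e he => (hF e).mp (by rw [hFRK]; simp [he])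
  obtain ⟨n, H, h1, h2, h3, h4⟩ := hK.extract hT.isAcyclic hKT
  set L := TD.sub T R s hRT with hL
  have hLe : L.edgeSet = (R : Set (Sym2 V)) := TD.sub_edgeSet _ _ _ _
  have hcov : ∀ e ∈ T.edgeSet, ∃ i, e ∈ ((Fin.snoc H L : Fin (n+1) → T.Subgraph) i).edgeSet := by
    intro e he
    have := (hF e).mpr he
    rw [hFRK, Finset.mem_union] at this
    rcases this with h | h
    · exact ⟨Fin.last n, by rw [Fin.snoc_last, hLe]; exact h⟩
    · obtain ⟨i, hi⟩ := (h4 e).mp h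
      exact ⟨i.castSucc, by rw [Fin.snoc_castSucc]; exact hi⟩
  have hLH : ∀ i, Disjoint L.edgeSet (H i).edgeSet := by
    intro i
    rw [hLe, Set.disjoint_left]
    intro e he hi
    exact Finset.disjoint_left.mp hRK he ((h4 e).mpr ⟨i, hi⟩)
  refine ⟨n, Fin.snoc H L, ?_, ?_, hcov, ?_, ?_, ?_, ?_⟩
  · intro i
    refine Fin.lastCases ?_ (fun i => ?_) i
    · rw [Fin.snoc_last]; exact TD.sub_connected _ _ _ _ hR.conn
    · rw [Fin.snoc_castSucc]; exact h1 i
  · intro v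
    by_cases hv : v = s
    · refine ⟨Fin.last n, ?_⟩
      rw [Fin.snoc_last]; exact Or.inl hv
    · obtain ⟨w⟩ := hT.connected.preconnected v s
      cases w with
      | nil => exact absurd rfl hv
      | @cons _ x _ hadj _ =>
        obtain ⟨i, hi⟩ := hcov s(v, x) hadj
        exact ⟨i, SimpleGraph.Subgraph.edge_vert _ hi⟩
  · intro i j
    refine Fin.lastCases ?_ (fun i => ?_) i <;> refine Fin.lastCases ?_ (fun j => ?_) j
    · simp
    · intro _; simpa using hLH j
    · intro _; simpa using (hLH i).symm
    · intro hij; simpa using h3 i j (by rintro rfl; exact hij rfl)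
  · rw [Fin.snoc_last, hLe, Set.ncard_coe_finset]; exact hR.card
  · rw [Fin.snoc_last, hLe]
    intro h
    exact hR.inc (by simpa using h)
  · intro i
    refine Fin.lastCases ?_ (fun i => ?_) i
    · simp
    · intro _; rw [Fin.snoc_castSucc]; exact h2 i
end
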